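/- arXiv:1708.06058 — 7 statements merged into one kernel-verified Lean document; each statement's English description precedes it below -/
import Mathlib

section
/- Let m, n, t be positive integers with t ≥ 2, and let D be a defining set of the full (m,n,t)-balanced rectangle F_{m,n,t}. Then for every pair of distinct symbols a, b ∈ {1,…,t}, the number of cells of D that contain neither a nor b satisfies |S_{a,b}(D)| ≤ m + n − 1. -/
/-- An `(m,n,t)`-balanced rectangle: an `m × n` array of multisets of elements of `{1,…,t}`,
each cell of size `t`, with each symbol occurring exactly `n` times in each row and exactly
`m` times in each column. -/
def IsBalancedRect (m n t : ℕ) (L : Fin m → Fin n → Multiset (Fin t)) : Prop :=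
  (∀ i j, (L i j).card = t) ∧
  (∀ (i : Fin m) (s : Fin t), ∑ j, (L i j).count s = n) ∧
  (∀ (j : Fin n) (s : Fin t), ∑ i, (L i j).count s = m)

/-- A partial `(m,n,t)`-balanced rectangle: cells of size at most `t`, each symbol
occurring at most `n` times per row and at most `m` times per column. -/
def IsPartialRect (m n t : ℕ) (D : Fin m → Fin n → Multiset (Fin t)) : Prop :=
  (∀ i j, (D i j).card ≤ t) ∧
  (∀ (i : Fin m) (s : Fin t), ∑ j, (D i j).count s ≤ n) ∧
  (∀ (j : Fin n) (s : Fin t), ∑ i, (D i j).count s ≤ m)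

/-- The full `(m,n,t)`-balanced rectangle: each cell is the set `{1,…,t}`. -/
def fullRect (m n t : ℕ) : Fin m → Fin n → Multiset (Fin t) :=
  fun _ _ => (Finset.univ : Finset (Fin t)).val

/-- `D` is a defining set of the full `(m,n,t)`-balanced rectangle: `D` is a partial
balanced rectangle contained in the full rectangle, and the full rectangle is the unique
balanced rectangle to which `D` completes. -/
def IsDefiningSetRect (m n t : ℕ) (D : Fin m → Fin n → Multiset (Fin t)) : Prop :=
  IsPartialRect m n t D ∧
  (∀ i j, D i j ≤ fullRect m n t i j) ∧
  ∀ L : Fin m → Fin n → Multiset (Fin t),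
    IsBalancedRect m n t L → (∀ i j, D i j ≤ L i j) → L = fullRect m n t

/-- Net flow of a walk from `x` to `y`. -/
def walkFlow {V : Type*} [DecidableEq V] {G : SimpleGraph V} {u v : V} (p : G.Walk u v)
    (x y : V) : ℤ :=
  ((p.darts.map (fun d => d.toProd)).count (x, y) : ℤ)
    - ((p.darts.map (fun d => d.toProd)).count (y, x) : ℤ)

lemma walkFlow_sum {V : Type*} [DecidableEq V] [Fintype V] {G : SimpleGraph V} {u v : V}
    (p : G.Walk u v) (x : V) :
    ∑ y, walkFlow p x y = (if x = u then 1 else 0) - (if x = v then 1 else 0) := by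
  induction p with
  | nil => simp [walkFlow]
  | @cons u w v h q ih =>
    have key : ∀ y, walkFlow (SimpleGraph.Walk.cons h q) x y = walkFlow q x y
        + ((if x = u then (if y = w then 1 else 0) else 0)
          - (if x = w then (if y = u then 1 else 0) else 0)) := by
      intro y
      simp only [walkFlow, SimpleGraph.Walk.darts_cons, List.map_cons, List.count_cons,
        beq_iff_eq, Prod.mk.injEq]
      push_cast
      split_ifs <;> grind
    simp only [key, Finset.sum_add_distrib, Finset.sum_sub_distrib, ih]
    by_cases h1 : x = u <;> by_cases h2 : x = w <;> simp [h1, h2] <;> grind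

lemma walkFlow_eq_zero {V : Type*} [DecidableEq V] {G : SimpleGraph V} {u v : V}
    (p : G.Walk u v) (x y : V) (h : ¬ G.Adj x y) : walkFlow p x y = 0 := by
  have h1 : (x, y) ∉ p.darts.map (fun d => d.toProd) := by
    intro hh
    obtain ⟨d, -, hd⟩ := List.mem_map.1 hh
    have := d.adj
    rw [hd] at this
    exact h this
  have h2 : (y, x) ∉ p.darts.map (fun d => d.toProd) := by
    intro hh
    obtain ⟨d, -, hd⟩ := List.mem_map.1 hh
    have := d.adj
    rw [hd] at this
    exact h this.symm
  simp [walkFlow, List.count_eq_zero_of_not_mem h1, List.count_eq_zero_of_not_mem h2]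

lemma count_add_le {V : Type*} [DecidableEq V] {G : SimpleGraph V} {u v : V}
    (p : G.Walk u v) (x y : V) (hxy : x ≠ y) :
    (p.darts.map (fun d => d.toProd)).count (x, y)
      + (p.darts.map (fun d => d.toProd)).count (y, x) = p.edges.count s(x, y) := by
  induction p with
  | nil => simp
  | @cons u w v h q ih =>
    simp only [SimpleGraph.Walk.darts_cons, SimpleGraph.Walk.edges_cons, List.map_cons,
      List.count_cons, beq_iff_eq, Prod.mk.injEq, Sym2.eq_iff, ← ih]
    split_ifs <;> grind

/-- The bipartite graph of a set of cells. -/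
def cellGraph {m n : ℕ} (S : Finset (Fin m × Fin n)) : SimpleGraph (Fin m ⊕ Fin n) where
  Adj x y := (∃ q ∈ S, x = Sum.inl q.1 ∧ y = Sum.inr q.2) ∨
    (∃ q ∈ S, y = Sum.inl q.1 ∧ x = Sum.inr q.2)
  symm := ⟨fun _ _ h => h.symm⟩
  loopless := ⟨by
    rintro x (⟨q, _, h1, h2⟩ | ⟨q, _, h1, h2⟩) <;> simp [h1] at h2⟩

lemma exists_cycle {m n : ℕ} (hm : 0 < m) (S : Finset (Fin m × Fin n))
    (hS : m + n ≤ S.card) : ¬ (cellGraph S).IsAcyclic := by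
  classical
  intro hac
  haveI : Nonempty (Fin m ⊕ Fin n) := ⟨Sum.inl ⟨0, hm⟩⟩
  obtain ⟨T, hT1, hT2, hT3⟩ :=
    (SimpleGraph.connected_top (V := Fin m ⊕ Fin n)).exists_isTree_le_of_le_of_isAcyclic
      (le_top : cellGraph S ≤ ⊤) hac
  have hc := hT3.card_edgeFinset
  have hle : S.card ≤ T.edgeFinset.card := by
    refine Finset.card_le_card_of_injOn (fun q => s(Sum.inl q.1, Sum.inr q.2)) ?_ ?_
    · intro q hq
      simp only [Finset.mem_coe, SimpleGraph.mem_edgeFinset, SimpleGraph.mem_edgeSet]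
      exact hT1 (Or.inl ⟨q, hq, rfl, rfl⟩)
    · intro q _ r _ h
      simp [Sym2.eq_iff] at h
      exact Prod.ext h.1 h.2
  simp at hc
  omega

lemma exists_trade {m n : ℕ} (hm : 0 < m) (S : Finset (Fin m × Fin n))
    (hS : m + n ≤ S.card) : ∃ f : Fin m → Fin n → ℤ,
      (∀ i j, -1 ≤ f i j ∧ f i j ≤ 1) ∧ (∀ i j, (i, j) ∉ S → f i j = 0) ∧
      (∀ i, ∑ j, f i j = 0) ∧ (∀ j, ∑ i, f i j = 0) ∧ ∃ i j, f i j ≠ 0 := by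
  classical
  have h := exists_cycle hm S hS
  simp only [SimpleGraph.IsAcyclic, not_forall, not_not] at h
  obtain ⟨v, c, hc⟩ := h
  have hnd := hc.edges_nodup
  have hadj : ∀ i j, (cellGraph S).Adj (Sum.inl i) (Sum.inr j) → (i, j) ∈ S := by
    rintro i j (⟨q, hq, h1, h2⟩ | ⟨q, hq, h1, h2⟩)
    · simp at h1 h2
      subst h1 h2
      exact hq
    · simp at h1
  have hll : ∀ i i', ¬ (cellGraph S).Adj (Sum.inl i) (Sum.inl i') := by
    simp [cellGraph]
  have hrr : ∀ i i', ¬ (cellGraph S).Adj (Sum.inr i) (Sum.inr i') := by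
    simp [cellGraph]
  have hcount : ∀ e, c.edges.count e ≤ 1 := List.nodup_iff_count_le_one.1 hnd
  refine ⟨fun i j => walkFlow c (Sum.inl i) (Sum.inr j), ?_, ?_, ?_, ?_, ?_⟩
  · intro i j
    have h1 := count_add_le c (Sum.inl i) (Sum.inr j) (by simp)
    have h2 := hcount s(Sum.inl i, Sum.inr j)
    simp only [walkFlow]
    omega
  · intro i j hij
    exact walkFlow_eq_zero _ _ _ (fun h => hij (hadj i j h))
  · intro i
    have := walkFlow_sum c (Sum.inl i)
    rw [Fintype.sum_sum_type] at this
    simpa [walkFlow_eq_zero c _ _ (hll _ _)] using this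
  · intro j
    have := walkFlow_sum c (Sum.inr j)
    rw [Fintype.sum_sum_type] at this
    simp only [walkFlow_eq_zero c _ _ (hrr _ _), Finset.sum_const_zero, add_zero, sub_self] at this
    have h2 : ∀ i, walkFlow c (Sum.inl i) (Sum.inr j) = - walkFlow c (Sum.inr j) (Sum.inl i) := by
      intro i
      simp [walkFlow]
    simp [h2, this]
  · have h3 := hc.three_le_length
    rw [← SimpleGraph.Walk.length_edges] at h3
    obtain ⟨e, he⟩ := List.exists_mem_of_length_pos (l := c.edges) (by omega)
    have heG := c.edges_subset_edgeSet he
    have main : ∃ q : Fin m × Fin n, e = s(Sum.inl q.1, Sum.inr q.2) := by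
      induction e using Sym2.ind with
      | _ x y =>
        rcases heG with ⟨q, hq, h1, h2⟩ | ⟨q, hq, h1, h2⟩
        · dsimp only at h1 h2
          exact ⟨q, by rw [h1, h2]⟩
        · dsimp only at h1 h2
          exact ⟨q, by rw [h1, h2, Sym2.eq_swap]⟩
    obtain ⟨q, rfl⟩ := main
    refine ⟨q.1, q.2, ?_⟩
    have h1 := count_add_le c (Sum.inl q.1) (Sum.inr q.2) (by simp)
    have h2 := hcount s(Sum.inl q.1, Sum.inr q.2)
    have h4 := List.count_pos_iff.2 he
    simp only [walkFlow]
    omega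

/-- If `D` is a defining set of `F_{m,n,t}` (with `t ≥ 2`), then for every pair of distinct
symbols `a, b`, the number of cells of `D` containing neither `a` nor `b` is at most
`m + n − 1`. -/
theorem card_cells_missing_pair_le (m n t : ℕ) (hm : 0 < m) (hn : 0 < n) (ht : 2 ≤ t)
    (D : Fin m → Fin n → Multiset (Fin t)) (hD : IsDefiningSetRect m n t D) :
    ∀ a b : Fin t, a ≠ b →
      (Finset.univ.filter
        (fun p : Fin m × Fin n => a ∉ D p.1 p.2 ∧ b ∉ D p.1 p.2)).card ≤ m + n - 1 := by
  intro a b hab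
  by_contra hcon
  obtain ⟨f, hf1, hf2, hf3, hf4, i0, j0, hf5⟩ := exists_trade hm
    (Finset.univ.filter (fun p : Fin m × Fin n => a ∉ D p.1 p.2 ∧ b ∉ D p.1 p.2)) (by omega)
  obtain ⟨-, hDF, huniq⟩ := hD
  let g : Fin m → Fin n → Fin t → ℕ := fun i j s =>
    if s = a then (1 + f i j).toNat else if s = b then (1 - f i j).toNat else 1
  have hg : ∀ i j s, (g i j s : ℤ) =
      1 + ((if s = a then f i j else 0) - (if s = b then f i j else 0)) := by
    intro i j s
    have := hf1 i j
    simp only [g]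
    split_ifs with h1 h2 h2
    · exact absurd (h1.symm.trans h2) hab
    · omega
    · omega
    · simp
  let L : Fin m → Fin n → Multiset (Fin t) := fun i j =>
    ∑ s, Multiset.replicate (g i j s) s
  have hL : ∀ i j s, (L i j).count s = g i j s := by
    intro i j s
    simp [L, Multiset.count_sum', Multiset.count_replicate]
  have hbal : IsBalancedRect m n t L := by
    refine ⟨?_, ?_, ?_⟩
    · intro i j
      have : (L i j).card = ∑ s, g i j s := by simp [L]
      rw [this]
      zify
      simp [hg, Finset.sum_add_distrib]
    · intro i s
      simp only [hL]
      zify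
      simp only [hg, Finset.sum_add_distrib, Finset.sum_sub_distrib]
      by_cases h1 : s = a <;> by_cases h2 : s = b <;> simp [h1, h2, hf3]
    · intro j s
      simp only [hL]
      zify
      simp only [hg, Finset.sum_add_distrib, Finset.sum_sub_distrib]
      by_cases h1 : s = a <;> by_cases h2 : s = b <;> simp [h1, h2, hf4]
  have hDL : ∀ i j, D i j ≤ L i j := by
    intro i j
    rw [Multiset.le_iff_count]
    intro s
    rw [hL]
    have h1 := Multiset.le_iff_count.1 (hDF i j) s
    have h2 : (fullRect m n t i j).count s = 1 :=
      Multiset.count_eq_one_of_mem (Finset.univ : Finset (Fin t)).nodup (Finset.mem_univ s)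
    have h3 := hg i j s
    by_cases hf : f i j = 0
    · simp [hf] at h3
      omega
    · have hmem : a ∉ D i j ∧ b ∉ D i j := by
        by_contra hh
        exact hf (hf2 i j (by simpa using hh))
      by_cases hsa : s = a
      · rw [hsa, Multiset.count_eq_zero_of_notMem hmem.1]; omega
      by_cases hsb : s = b
      · rw [hsb, Multiset.count_eq_zero_of_notMem hmem.2]; omega
      simp [hsa, hsb] at h3
      omega
  have heq := huniq L hbal hDL
  have h1 := hL i0 j0 a
  have h2 : (fullRect m n t i0 j0).count a = 1 :=
    Multiset.count_eq_one_of_mem (Finset.univ : Finset (Fin t)).nodup (Finset.mem_univ a)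
  have h3 := hg i0 j0 a
  rw [heq, h2] at h1
  simp [hab, ← h1] at h3
  exact hf5 h3
end

section
/- Let G be a simple graph with v vertices and more than ⌊(4v−3)/3⌋ edges. Then G contains an even circuit, i.e., a closed trail of even positive length. -/
open SimpleGraph in
theorem aux_comp_count {V : Type*} [Fintype V] [DecidableEq V] (G H : SimpleGraph V) (hle : H ≤ G)
    (T : Finset V) (hT : ∀ a ∈ T, ∀ b ∈ T, G.Reachable a b)
    (hT' : ∀ a ∈ T, ∀ b ∈ T, H.Reachable a b → a = b) :
    Nat.card G.ConnectedComponent + T.card ≤ Nat.card H.ConnectedComponent + 1 := by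
  classical
  have key : Nat.card G.ConnectedComponent ≤
      ((Finset.univ \ T.image H.connectedComponentMk).image
        (ConnectedComponent.map (Hom.ofLE hle))).card + 1 := by
    rcases T.eq_empty_or_nonempty with rfl | ⟨t, ht⟩
    · simp only [Finset.image_empty, Finset.sdiff_empty]
      rw [Finset.image_univ_of_surjective, Finset.card_univ, Nat.card_eq_fintype_card]
      · omega
      · intro c
        induction c using ConnectedComponent.ind with | h v => exact ⟨H.connectedComponentMk v, rfl⟩
    · rw [Nat.card_eq_fintype_card, ← Finset.card_univ]
      refine le_trans (Finset.card_le_card (t := insert (G.connectedComponentMk t) _) ?_)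
        (Finset.card_insert_le _ _)
      intro c _
      induction c using ConnectedComponent.ind with | h v =>
      by_cases hv : H.connectedComponentMk v ∈ T.image H.connectedComponentMk
      · obtain ⟨a, ha, hav⟩ := Finset.mem_image.1 hv
        rw [ConnectedComponent.eq] at hav
        refine Finset.mem_insert.2 (Or.inl ?_)
        rw [ConnectedComponent.eq]
        exact (hav.symm.mono hle).trans (hT a ha t ht)
      · refine Finset.mem_insert.2 (Or.inr ?_)
        exact Finset.mem_image.2 ⟨H.connectedComponentMk v, by simpa using hv, rfl⟩
  have h2 := Finset.card_image_le (s := Finset.univ \ T.image H.connectedComponentMk)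
    (f := ConnectedComponent.map (Hom.ofLE hle))
  rw [Finset.card_sdiff_of_subset (Finset.subset_univ _), Finset.card_univ] at h2
  have h3 : (T.image H.connectedComponentMk).card = T.card := by
    apply Finset.card_image_of_injOn
    intro a ha b hb hab
    exact hT' a ha b hb (ConnectedComponent.eq.1 hab)
  have h4 := Finset.card_le_univ (T.image H.connectedComponentMk)
  rw [Nat.card_eq_fintype_card (α := H.ConnectedComponent)]
  omega

open SimpleGraph in
theorem aux_main {V : Type*} [Fintype V] [DecidableEq V] (m : ℕ) : ∀ (G : SimpleGraph V),
    G.edgeSet.ncard = m →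
    (∀ (u : V) (p : G.Walk u u), p.IsCircuit → ¬ Even p.length) →
    ∀ S : Finset V, (∀ (u : V) (p : G.Walk u u), p.IsCircuit → u ∈ S) →
    3 * m + 3 * Nat.card G.ConnectedComponent ≤ 3 * Fintype.card V + S.card := by
  classical
  induction m using Nat.strong_induction_on with | _ m ih =>
  intro G hm hG S hS
  -- monotonicity of circuits
  have hmono : ∀ (H : SimpleGraph V) (hle : H ≤ G) (u : V) (p : H.Walk u u), p.IsCircuit →
      (p.mapLe hle).IsCircuit := by
    intro H hle u p hp
    refine ⟨hp.isTrail.mapLe hle, fun h => ?_⟩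
    have h1 := hp.three_le_length
    have h2 := congrArg Walk.length h
    rw [Walk.length_mapLe, Walk.length_nil] at h2
    omega
  by_cases hac : ∃ (u : V) (c : G.Walk u u), c.IsCycle
  · obtain ⟨u, c, hc⟩ := hac
    have hle : G.deleteEdges {e | e ∈ c.edges} ≤ G := deleteEdges_le _
    generalize hH : G.deleteEdges {e | e ∈ c.edges} = H at hle
    have hHE : H.edgeSet = G.edgeSet \ {e | e ∈ c.edges} := by rw [← hH, edgeSet_deleteEdges]
    have hdisj : ∀ (a b : V) (q : H.Walk a b), ∀ e ∈ (q.mapLe hle).edges, e ∉ c.edges := by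
      intro a b q e he hec
      have h1 : e ∈ q.edges := by simpa using he
      have h2 := q.edges_subset_edgeSet h1
      rw [hHE] at h2
      exact h2.2 hec
    have hk := hc.three_le_length
    have hodd := hG u c hc.isCircuit
    have hcE : ({e | e ∈ c.edges} : Set (Sym2 V)).ncard = c.length := by
      have : ({e | e ∈ c.edges} : Set (Sym2 V)) = (c.edges.toFinset : Set (Sym2 V)) := by
        ext; simp
      rw [this, Set.ncard_coe_finset, List.toFinset_card_of_nodup hc.edges_nodup, Walk.length_edges]
    have hcard : H.edgeSet.ncard + c.length = m := by
      rw [hHE, ← hcE, ← hm]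
      exact Set.ncard_sdiff_add_ncard_of_subset (fun e he => c.edges_subset_edgeSet he)
        (Set.toFinite _)
    let T := c.support.tail.toFinset
    have hTc : T.card = c.length := by
      rw [List.toFinset_card_of_nodup hc.support_nodup]; simp
    have hTs : ∀ a ∈ T, a ∈ c.support := fun a ha => List.mem_of_mem_tail (by simpa [T] using ha)
    have hTS : T ⊆ S := fun a ha => hS a (c.rotate a (hTs a ha)) (by simpa using hc.isCircuit)
    have hcomp := aux_comp_count G H hle T
      (fun a ha b hb => ((c.takeUntil a (hTs a ha)).reachable).symm.trans
        (c.takeUntil b (hTs b hb)).reachable) (by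
      intro a ha b hb hr
      by_contra hab
      obtain ⟨P, hP⟩ := hr.exists_isPath
      have hPt : (P.mapLe hle).IsTrail := hP.isTrail.mapLe hle
      have hPd := hdisj a b P
      generalize P.mapLe hle = Q at hPt hPd
      have hR : (c.rotate a (hTs a ha)).IsCircuit := by simpa using hc.isCircuit
      have hRe : ∀ e, e ∈ (c.rotate a (hTs a ha)).edges ↔ e ∈ c.edges :=
        fun e => (c.rotate_edges a (hTs a ha)).mem_iff
      have hRl : (c.rotate a (hTs a ha)).length = c.length := by simp
      have hRb : b ∈ (c.rotate a (hTs a ha)).support := by simpa using hTs b hb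
      generalize c.rotate a (hTs a ha) = R at hR hRe hRl hRb
      have hsp := R.take_spec hRb
      generalize R.takeUntil b hRb = A at hsp
      generalize R.dropUntil b hRb = B at hsp
      subst hsp
      have hAB := (Walk.isTrail_append _ _).1 hR.isTrail
      simp only [Walk.edges_append, List.mem_append] at hRe
      rw [Walk.length_append] at hRl
      have hQ : Q.length ≠ 0 := fun h => hab (Walk.eq_of_length_eq_zero h)
      have h1 := hG a (Q.append B) ⟨(Walk.isTrail_append _ _).2 ⟨hPt, hAB.2.1,
        fun e he he' => hPd e he ((hRe e).1 (Or.inr he'))⟩, fun h => by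
          have := congrArg Walk.length h
          rw [Walk.length_append, Walk.length_nil] at this
          omega⟩
      have h2 := hG a (A.append Q.reverse) ⟨(Walk.isTrail_append _ _).2 ⟨hAB.1,
        (Walk.reverse_isTrail_iff _).2 hPt,
        fun e he he' => hPd e (by simpa using he') ((hRe e).1 (Or.inl he))⟩, fun h => by
          have := congrArg Walk.length h
          rw [Walk.length_append, Walk.length_nil, Walk.length_reverse] at this
          omega⟩
      rw [Walk.length_append] at h1 h2
      rw [Walk.length_reverse] at h2
      rw [Nat.even_iff] at h1 h2 hodd
      omega)
    have := ih H.edgeSet.ncard (by omega) H rfl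
      (fun a p hp => by simpa using hG a _ (hmono H hle a p hp)) (S \ T) (by
      intro a p hp
      have hp' := hmono H hle a p hp
      refine Finset.mem_sdiff.2 ⟨hS a _ hp', fun ha => ?_⟩
      have hpo := hG a _ hp'
      refine hG a ((p.mapLe hle).append (c.rotate a (hTs a ha)))
        ⟨(Walk.isTrail_append _ _).2 ⟨hp'.isTrail, by simpa using hc.isCircuit.isTrail,
          fun e he he' => hdisj a a p e he ((c.rotate_edges a (hTs a ha)).mem_iff.1 he')⟩, 
          fun h => ?_⟩ ?_
      · have := congrArg Walk.length h
        rw [Walk.length_append, Walk.length_nil, Walk.length_rotate] at this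
        omega
      · rw [Walk.length_append, Walk.length_rotate]
        rw [Nat.even_iff] at *
        omega)
    rw [Finset.card_sdiff_of_subset hTS] at this
    have := Finset.card_le_card hTS
    omega
  · by_cases hE : ∃ a b, G.Adj a b
    · obtain ⟨a, b, hab⟩ := hE
      have hbr : G.IsBridge s(a, b) := (isBridge_iff_forall_cycle_notMem hab).2
        fun u p hp => (hac ⟨u, p, hp⟩).elim
      rw [isBridge_iff] at hbr
      have hle : G.deleteEdges {s(a, b)} ≤ G := deleteEdges_le _
      generalize hH : G.deleteEdges {s(a, b)} = H at hle hbr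
      have hHE : H.edgeSet = G.edgeSet \ {s(a, b)} := by rw [← hH, edgeSet_deleteEdges]
      have hcard : H.edgeSet.ncard + 1 = m := by
        rw [hHE, ← hm]
        exact Set.ncard_sdiff_singleton_add_one hab (Set.toFinite _)
      have hcomp := aux_comp_count G H hle {a, b} (by
        have := hab.reachable
        have := hab.symm.reachable
        simp_all) (by
        have : ¬ H.Reachable b a := fun h => hbr h.symm
        simp_all)
      rw [Finset.card_pair hab.ne] at hcomp
      have := ih H.edgeSet.ncard (by omega) H rfl
        (fun a p hp => by simpa using hG a _ (hmono H hle a p hp)) S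
        (fun a p hp => hS a _ (hmono H hle a p hp))
      omega
    · push Not at hE
      have h0 : G.edgeSet = ∅ := by
        ext e
        induction e with | h a b => simp [hE]
      rw [h0, Set.ncard_empty] at hm
      have : Nat.card G.ConnectedComponent ≤ Fintype.card V := by
        rw [← Nat.card_eq_fintype_card]
        exact Nat.card_le_card_of_surjective G.connectedComponentMk
          (fun c => by induction c using ConnectedComponent.ind with | h v => exact ⟨v, rfl⟩)
      omega

/-- Any simple graph on `v` vertices with more than `⌊(4v−3)/3⌋` edges contains an even
circuit, i.e. a closed trail of even positive length. -/
theorem exists_even_circuit_of_many_edges {V : Type*} [Fintype V] [DecidableEq V]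
    (G : SimpleGraph V) [DecidableRel G.Adj]
    (h : (4 * Fintype.card V - 3) / 3 < G.edgeFinset.card) :
    ∃ (u : V) (p : G.Walk u u), p.IsCircuit ∧ Even p.length := by
  by_contra hcon
  push Not at hcon
  have h1 := aux_main G.edgeSet.ncard G rfl (fun u p hp => Nat.not_even_iff_odd.2 (by simpa using hcon u p hp))
    Finset.univ (fun _ _ _ => Finset.mem_univ _)
  rw [← SimpleGraph.coe_edgeFinset, Set.ncard_coe_finset, Finset.card_univ] at h1
  have h2 : 0 < Nat.card G.ConnectedComponent := by
    obtain ⟨e, he⟩ := Finset.card_pos.1 (Nat.zero_lt_of_lt h)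
    induction e with | h a b =>
    have : Nonempty G.ConnectedComponent := ⟨G.connectedComponentMk a⟩
    exact Nat.card_pos
  omega
end

section
/- Let G be a simple graph containing no even circuit (no closed trail of even positive length). Then any two distinct cycles of G are vertex-disjoint. -/
open SimpleGraph in
theorem aux_prefix {V : Type*} {G : SimpleGraph V} (S : Set V) (E : Set (Sym2 V))
    (hE : ∀ a b, s(a, b) ∈ E → a ∈ S ∧ b ∈ S) {u v : V} (q : G.Walk u v)
    (hq : q.IsTrail) (hv : v ∈ S) :
    ∃ (b : V) (R : G.Walk u b), b ∈ S ∧ R.IsTrail ∧ (∀ e ∈ R.edges, e ∈ q.edges) ∧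
      (∀ e ∈ R.edges, e ∉ E) := by
  induction q with
  | nil => exact ⟨_, Walk.nil, hv, by simp, by simp, by simp⟩
  | @cons a c d hac q ih =>
    by_cases ha : a ∈ S
    · exact ⟨a, Walk.nil, ha, by simp, by simp, by simp⟩
    · rw [Walk.isTrail_cons] at hq
      obtain ⟨b, R, hb, hR, hs, hd⟩ := ih hq.1 hv
      refine ⟨b, Walk.cons hac R, hb, ?_, ?_, ?_⟩
      · rw [Walk.isTrail_cons]
        exact ⟨hR, fun hm => hq.2 (hs _ hm)⟩
      · intro e he
        rw [Walk.edges_cons, List.mem_cons] at he ⊢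
        exact he.imp id (hs e)
      · intro e he
        rw [Walk.edges_cons, List.mem_cons] at he
        rcases he with rfl | he
        · exact fun hm => ha (hE _ _ hm).1
        · exact hd e he

open SimpleGraph in
theorem aux_ear {V : Type*} {G : SimpleGraph V} (S : Set V) (E : Set (Sym2 V))
    (hE : ∀ a b, s(a, b) ∈ E → a ∈ S ∧ b ∈ S) {u v : V} (q : G.Walk u v)
    (hq : q.IsTrail) (hu : u ∈ S) (hv : v ∈ S) (e : Sym2 V) (he : e ∈ q.edges) (heE : e ∉ E) :
    ∃ (a b : V) (R : G.Walk a b), a ∈ S ∧ b ∈ S ∧ R.IsTrail ∧ 0 < R.length ∧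
      (∀ e ∈ R.edges, e ∉ E) := by
  induction q with
  | nil => simp at he
  | @cons a c d hac q ih =>
    rw [Walk.isTrail_cons] at hq
    by_cases hm : s(a, c) ∈ E
    · rw [Walk.edges_cons, List.mem_cons] at he
      rcases he with rfl | he
      · exact absurd hm heE
      · exact ih hq.1 (hE _ _ hm).2 hv he
    · obtain ⟨b, R, hb, hR, hs, hd⟩ := aux_prefix S E hE q hq.1 hv
      refine ⟨a, b, Walk.cons hac R, hu, hb, ?_, by simp, ?_⟩
      · rw [Walk.isTrail_cons]
        exact ⟨hR, fun hm => hq.2 (hs _ hm)⟩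
      · intro e he
        rw [Walk.edges_cons, List.mem_cons] at he
        rcases he with rfl | he
        · exact hm
        · exact hd e he

open SimpleGraph in
theorem aux_main_s5 {V : Type*} (G : SimpleGraph V)
    (h : ∀ (u : V) (p : G.Walk u u), p.IsCircuit → ¬ Even p.length)
    (u w : V) (p : G.Walk u u) (q : G.Walk w w) (hp : p.IsCircuit) (hq : q.IsTrail)
    (x : V) (hxp : x ∈ p.support) (hxq : x ∈ q.support)
    (e : Sym2 V) (he : e ∈ q.edges) (hep : e ∉ p.edges) : False := by
  classical
  obtain ⟨a, b, R, ha, hb, hR, hpos, hd⟩ := aux_ear {v | v ∈ p.support} {e | e ∈ p.edges}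
    (fun a b hab => ⟨p.fst_mem_support_of_mem_edges hab, p.snd_mem_support_of_mem_edges hab⟩)
    (q.rotate x hxq) (hq.rotate hxq) hxp hxp e ((q.rotate_edges x hxq).mem_iff.2 he) hep
  have hr : (p.rotate a ha).IsCircuit := hp.rotate ha
  have hmem : ∀ e, e ∈ (p.rotate a ha).edges ↔ e ∈ p.edges :=
    fun e => (p.rotate_edges a ha).mem_iff
  have hb' : b ∈ (p.rotate a ha).support := by
    by_cases hba : b = a
    · subst hba; simp
    · have := hb
      simp_all
  generalize p.rotate a ha = p' at hr hmem hb'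
  have hodd := h _ p' hr
  have hspec := p'.take_spec hb'
  generalize p'.takeUntil b hb' = P1 at hspec
  generalize p'.dropUntil b hb' = P2 at hspec
  subst hspec
  have hT := hr.isTrail
  have key : ∀ P : G.Walk b a, P.IsTrail → (∀ e ∈ P.edges, e ∈ p.edges) →
      ¬ Even (R.length + P.length) := by
    intro P hP hs
    rw [← Walk.length_append]
    refine h a (R.append P) ⟨?_, ?_⟩
    · rw [Walk.isTrail_append]
      exact ⟨hR, hP, fun e h1 h2 => hd e h1 (hs e h2)⟩
    · intro hn
      have := congrArg Walk.length hn
      rw [Walk.length_append, Walk.length_nil] at this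
      omega
  have k1 := key P1.reverse hT.of_append_left.reverse
    (fun e he => (hmem e).1 (by simp at he; simp [he]))
  have k2 := key P2 hT.of_append_right (fun e he => (hmem e).1 (by simp [he]))
  simp only [Walk.length_append, Walk.length_reverse] at hodd k1 k2
  grind

/-- If a simple graph contains no even circuit (no closed trail of even positive length),
then any two distinct cycles (cycles with different edge sets) are vertex-disjoint. -/
theorem cycles_vertex_disjoint_of_no_even_circuit {V : Type*} (G : SimpleGraph V)
    (h : ∀ (u : V) (p : G.Walk u u), p.IsCircuit → ¬ Even p.length) :
    ∀ (u w : V) (p : G.Walk u u) (q : G.Walk w w), p.IsCycle → q.IsCycle →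
      {e | e ∈ p.edges} ≠ {e | e ∈ q.edges} →
      ∀ x : V, x ∈ p.support → x ∉ q.support := by
  intro u w p q hp hq hne x hxp hxq
  apply hne
  ext e
  constructor
  · intro he
    by_contra hn
    exact aux_main_s5 G h w u q p hq.isCircuit hp.isCircuit.isTrail x hxq hxp e he hn
  · intro he
    by_contra hn
    exact aux_main_s5 G h u w p q hp.isCircuit hq.isCircuit.isTrail x hxp hxq e he hn
end

section
/- Let v ≥ 4 and let D be a subset of the full design F(v,3). Suppose there exist distinct points a, b ∈ {1,…,v} such that s_{a,b}(D) > ⌊(4v−11)/3⌋. Then D is not a defining set for F(v,3). -/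
/-- The full design on point set `P` with block size `k`: all `k`-element subsets of `P`. -/
def fullDesignOn {α : Type*} [DecidableEq α] (P : Finset α) (k : ℕ) : Finset (Finset α) :=
  P.powersetCard k

/-- A `(P, k, lam)`-design: a multiset of `k`-element subsets (blocks) of the point set `P`
such that every unordered pair of distinct points of `P` lies in exactly `lam` blocks
(repeated blocks are allowed). -/
def IsDesignOn {α : Type*} [DecidableEq α] (P : Finset α) (k lam : ℕ)
    (B : Multiset (Finset α)) : Prop :=
  (∀ b ∈ B, b ⊆ P ∧ b.card = k) ∧
  ∀ i ∈ P, ∀ j ∈ P, i ≠ j → Multiset.countP (fun b => i ∈ b ∧ j ∈ b) B = lam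

/-- `D` is a defining set for the full design on `P` with block size `k`: `D` is a set of
blocks of the full design, and the only `(P, k, C(|P|−2, k−2))`-design (repeated blocks
allowed) containing `D` is the full design. -/
def IsDefiningSetOn {α : Type*} [DecidableEq α] (P : Finset α) (k : ℕ)
    (D : Finset (Finset α)) : Prop :=
  D ⊆ fullDesignOn P k ∧
  ∀ B : Multiset (Finset α), IsDesignOn P k ((P.card - 2).choose (k - 2)) B →
    D.val ≤ B → B = (fullDesignOn P k).val

/-- `s_{a,b}(D)`: the number of unordered pairs `{i,j} ⊆ {1,…,v} \ {a,b}` such that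
neither the triple `{i,j,a}` nor the triple `{i,j,b}` belongs to `D`. -/
def sPair {α : Type*} [DecidableEq α] [Fintype α] (D : Finset (Finset α)) (a b : α) : ℕ :=
  (((Finset.univ \ {a, b}).powersetCard 2).filter
    (fun q => insert a q ∉ D ∧ insert b q ∉ D)).card

open SimpleGraph in
theorem seg_right {V : Type*} {G : SimpleGraph V} (S : Set V) {u v : V} (P : G.Walk u v)
    (h : ∃ x ∈ P.support, x ∈ S) :
    ∃ q ∈ S, ∃ P2 : G.Walk q v, P2.edges.Sublist P.edges ∧
      ∀ e ∈ P2.edges, ∃ y ∈ e, y ∉ S := by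
  induction P with
  | nil =>
    obtain ⟨x, hx, hS⟩ := h
    simp at hx
    subst hx
    exact ⟨_, hS, Walk.nil, by simp, by simp⟩
  | @cons u w v hadj P ih =>
    by_cases h' : ∃ x ∈ P.support, x ∈ S
    · obtain ⟨q, hq, P2, h1, h2⟩ := ih h'
      exact ⟨q, hq, P2, by simpa using h1.cons _, h2⟩
    · push Not at h'
      obtain ⟨x, hx, hS⟩ := h
      have : x = u := by
        simp at hx
        rcases hx with hx | hx
        · exact hx
        · exact absurd hS (h' x hx)
      subst this
      refine ⟨x, hS, Walk.cons hadj P, List.Sublist.refl _, ?_⟩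
      intro e he
      simp at he
      rcases he with he | he
      · subst he
        exact ⟨w, by simp, h' w (by simp)⟩
      · induction e with
        | h a b =>
          exact ⟨a, by simp, h' a (P.fst_mem_support_of_mem_edges he)⟩

open SimpleGraph in
theorem seg_both {V : Type*} {G : SimpleGraph V} (S : Set V) {u v : V} (P : G.Walk u v)
    (h : ∃ x ∈ P.support, x ∈ S) :
    ∃ p ∈ S, ∃ q ∈ S, ∃ P1 : G.Walk u p, ∃ P2 : G.Walk q v,
      (P1.edges ++ P2.edges).Sublist P.edges ∧
      ∀ e ∈ P1.edges ++ P2.edges, ∃ y ∈ e, y ∉ S := by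
  induction P with
  | @nil u =>
    obtain ⟨x, hx, hS⟩ := h
    simp at hx
    subst hx
    exact ⟨_, hS, _, hS, Walk.nil, Walk.nil, by simp, by simp⟩
  | @cons u w v hadj P ih =>
    by_cases hu : u ∈ S
    · obtain ⟨q, hq, P2, h1, h2⟩ := seg_right S (Walk.cons hadj P) h
      exact ⟨u, hu, q, hq, Walk.nil, P2, by simpa using h1, by simpa using h2⟩
    · have h' : ∃ x ∈ P.support, x ∈ S := by
        obtain ⟨x, hx, hS⟩ := h
        simp at hx
        rcases hx with hx | hx
        · subst hx; exact absurd hS hu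
        · exact ⟨x, hx, hS⟩
      obtain ⟨p, hp, q, hq, P1, P2, h1, h2⟩ := ih h'
      refine ⟨p, hp, q, hq, Walk.cons hadj P1, P2, by simpa using h1, ?_⟩
      intro e he
      simp only [Walk.edges_cons, List.cons_append, List.mem_cons] at he
      rcases he with he | he
      · subst he
        exact ⟨u, by simp, hu⟩
      · exact h2 e he

open SimpleGraph in
theorem ear {V : Type*} {G : SimpleGraph V} {x u v : V} (c : G.Walk x x)
    (hc : c.IsTrail) (hodd : ¬ Even c.length) (P : G.Walk u v) (hP : P.IsTrail) (hadj : G.Adj u v)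
    (h1 : s(u, v) ∉ P.edges) (h2 : s(u, v) ∉ c.edges) (hx : ∃ x ∈ P.support, x ∈ c.support) :
    ∃ (z : V) (d : G.Walk z z), d.IsTrail ∧ 0 < d.length ∧ Even d.length := by
  classical
  obtain ⟨p, hp, q, hq, P1, P2, hs, he⟩ := seg_both {y | y ∈ c.support} P hx
  have hq' : q ∈ c.support := hq
  let c' := c.rotate q hq'
  have hpc : p ∈ c'.support := by
    simpa [c'] using hp
  have hc' : c'.IsTrail := by simpa [c'] using hc
  -- ear from p to q
  let Q : G.Walk p q := P1.reverse.append (Walk.cons hadj P2.reverse)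
  have hnd := hP.edges_nodup.sublist hs
  have hnot : s(u, v) ∉ P1.edges ++ P2.edges := fun hh => h1 (hs.subset hh)
  have hQe : ∀ e, e ∈ Q.edges ↔ (e = s(u, v) ∨ e ∈ P1.edges ++ P2.edges) := by
    intro e
    simp [Q]
    tauto
  have hQ : Q.IsTrail := by
    rw [Walk.isTrail_def]
    have : Q.edges.Perm (s(u, v) :: (P1.edges ++ P2.edges)) := by
      simp only [Q, Walk.edges_append, Walk.edges_reverse, Walk.edges_cons]
      refine List.perm_middle.trans (List.Perm.cons _ ?_)
      exact (List.reverse_perm _).append (List.reverse_perm _)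
    rw [this.nodup_iff]
    exact List.nodup_cons.2 ⟨hnot, hnd⟩
  have hce : ∀ e, e ∈ c'.edges → e ∈ c.edges := by
    intro e h
    exact (c.rotate_edges q hq').mem_iff.1 h
  have hdis : ∀ e, e ∈ Q.edges → e ∉ c'.edges := by
    intro e heQ hec
    have hec := hce e hec
    rcases (hQe e).1 heQ with h | h
    · subst h; exact h2 hec
    · obtain ⟨y, hy, hyS⟩ := he e h
      obtain ⟨y', rfl⟩ := Sym2.mem_iff_exists.1 hy
      exact hyS (c.fst_mem_support_of_mem_edges hec)
  have hQl : 0 < Q.length := by simp [Q]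
  have hlen : (c'.takeUntil p hpc).length + (c'.dropUntil p hpc).length = c.length := by
    rw [← Walk.length_append, Walk.take_spec]
    simp [c']
  have key : ∀ R : G.Walk q p, R.IsTrail → (∀ e ∈ R.edges, e ∈ c'.edges) →
      (Q.append R).IsTrail := by
    intro R hR hRe
    rw [Walk.isTrail_append]
    refine ⟨hQ, hR, ?_⟩
    intro e h1 h2
    exact hdis e h1 (hRe e h2)
  by_cases hev : Even (Q.length + (c'.takeUntil p hpc).length)
  · refine ⟨p, Q.append (c'.takeUntil p hpc), key _ (hc'.takeUntil hpc) ?_, ?_, ?_⟩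
    · exact fun e h => c'.edges_takeUntil_subset_edges hpc h
    · simp; omega
    · simpa using hev
  · refine ⟨p, Q.append (c'.dropUntil p hpc).reverse, key _ (hc'.dropUntil hpc).reverse ?_, ?_, ?_⟩
    · intro e h
      simp at h
      exact c'.edges_dropUntil_subset_edges hpc h
    · simp; omega
    · rw [← hlen] at hodd
      simp only [Walk.length_append, Walk.length_reverse]
      grind

open SimpleGraph in
theorem exists_even_trail {V : Type*} [Fintype V] [Nonempty V] (G : SimpleGraph V)
    [Fintype G.edgeSet]
    (hcard : 4 * Fintype.card V < 3 * G.edgeFinset.card + 3) :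
    ∃ (z : V) (d : G.Walk z z), d.IsTrail ∧ 0 < d.length ∧ Even d.length := by
  classical
  by_contra hno
  obtain ⟨F, hFG, hF, hreach⟩ := G.exists_isAcyclic_reachable_eq_le
  have hFc : F.edgeFinset.card + 1 ≤ Fintype.card V := by
    obtain ⟨T, hT, -, hTt⟩ := (connected_top (V := V)).exists_isTree_le_of_le_of_isAcyclic
      (le_top : F ≤ ⊤) hF
    have := hTt.card_edgeFinset
    have h2 := Finset.card_le_card (edgeFinset_mono hT)
    omega
  have main : ∀ A : Finset (Sym2 V), A ⊆ G.edgeFinset \ F.edgeFinset →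
      ∃ U : Finset V, 3 * A.card ≤ U.card ∧ ∀ x ∈ U, ∃ c : G.Walk x x, c.IsTrail ∧
        0 < c.length ∧ ∀ e ∈ c.edges, e ∈ F.edgeSet ∨ e ∈ A := by
    intro A
    induction A using Finset.induction_on with
    | empty => intro _; exact ⟨∅, by simp⟩
    | insert e A heA ih =>
      intro hA
      obtain ⟨U, hU, hUc⟩ := ih ((Finset.subset_insert _ _).trans hA)
      have he := hA (Finset.mem_insert_self e A)
      induction e with
      | h u v =>
      simp only [Finset.mem_sdiff, mem_edgeFinset, mem_edgeSet] at he
      obtain ⟨hadj, hnF⟩ := he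
      have hr : F.Reachable u v := by rw [hreach]; exact hadj.reachable
      obtain ⟨P0, hP0⟩ := hr.exists_isPath
      have hPl : 2 ≤ P0.length := by
        by_contra hlt
        have : P0.length = 0 ∨ P0.length = 1 := by omega
        rcases this with h | h
        · exact hadj.ne (Walk.eq_of_length_eq_zero h)
        · exact hnF (Walk.adj_of_length_eq_one h)
      have hP0e : ∀ e ∈ P0.edges, e ∈ F.edgeSet := fun e h => P0.edges_subset_edgeSet h
      let P : G.Walk u v := P0.mapLe hFG
      have hPe : P.edges = P0.edges := by simp [P]
      have hPs : P.support = P0.support := by simp [P]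
      have hP : P.IsTrail := by
        rw [Walk.isTrail_def, hPe]; exact hP0.isTrail.edges_nodup
      have huvP : s(u, v) ∉ P.edges := by
        rw [hPe]; intro h; exact hnF (hP0e _ h)
      by_cases hmeet : ∃ x ∈ U, x ∈ P.support
      · exfalso
        obtain ⟨x, hxU, hxP⟩ := hmeet
        obtain ⟨c, hc, hcl, hce⟩ := hUc x hxU
        by_cases hev : Even c.length
        · exact hno ⟨x, c, hc, hcl, hev⟩
        · refine hno (ear c hc hev P hP hadj huvP ?_ ⟨x, hxP, by simp⟩)
          intro h
          rcases hce _ h with h | h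
          · exact hnF h
          · exact heA h
      · push Not at hmeet
        refine ⟨U ∪ P0.support.toFinset, ?_, ?_⟩
        · rw [Finset.card_union_of_disjoint, Finset.card_insert_of_notMem heA,
            List.toFinset_card_of_nodup hP0.support_nodup, Walk.length_support]
          · omega
          · rw [Finset.disjoint_left]
            intro x hx hx'
            exact hmeet x hx (by rw [hPs]; simpa using hx')
        · intro x hx
          rw [Finset.mem_union] at hx
          rcases hx with hx | hx
          · obtain ⟨c, hc, hcl, hce⟩ := hUc x hx
            refine ⟨c, hc, hcl, fun e h => ?_⟩
            rcases hce e h with h | h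
            · exact Or.inl h
            · exact Or.inr (Finset.mem_insert_of_mem h)
          · let C : G.Walk v v := Walk.cons hadj.symm P
            have hC : C.IsTrail := by
              rw [Walk.isTrail_cons]
              exact ⟨hP, by rwa [Sym2.eq_swap]⟩
            have hxC : x ∈ C.support := by
              simp only [C, Walk.support_cons, hPs]
              exact List.mem_cons_of_mem _ (by simpa using hx)
            refine ⟨C.rotate x hxC, by simpa using hC, by simp [C], ?_⟩
            intro e h
            have h := (C.rotate_edges x hxC).mem_iff.1 h
            simp only [C, Walk.edges_cons, List.mem_cons, hPe] at h
            rcases h with h | h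
            · right; rw [h, Sym2.eq_swap]; simp
            · left; exact hP0e _ h
  obtain ⟨U, hU, -⟩ := main _ (Finset.Subset.refl _)
  have h1 := Finset.card_sdiff_add_card_eq_card (edgeFinset_mono hFG)
  have h2 := Finset.card_le_univ U
  omega

/-- Alternating sign vector of a walk, as a function on finsets. -/
def altW {V : Type*} [DecidableEq V] {G : SimpleGraph V} : {u v : V} → G.Walk u v → Finset V → ℤ
  | _, _, SimpleGraph.Walk.nil => fun _ => 0
  | u, _, SimpleGraph.Walk.cons (v := w) _ p => fun q => (if q = {u, w} then 1 else 0) - altW p q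

theorem pair_eq_iff' {V : Type*} [DecidableEq V] (u w x y : V) :
    ({u, w} : Finset V) = {x, y} ↔ s(u, w) = s(x, y) := by
  constructor
  · intro h
    have h1 : u ∈ ({x, y} : Finset V) := by rw [← h]; simp
    have h2 : w ∈ ({x, y} : Finset V) := by rw [← h]; simp
    have h3 : x ∈ ({u, w} : Finset V) := by rw [h]; simp
    have h4 : y ∈ ({u, w} : Finset V) := by rw [h]; simp
    simp only [Finset.mem_insert, Finset.mem_singleton] at h1 h2 h3 h4
    rw [Sym2.eq_iff]
    grind
  · intro h
    rw [Sym2.eq_iff] at h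
    rcases h with ⟨rfl, rfl⟩ | ⟨rfl, rfl⟩
    · rfl
    · exact Finset.pair_comm _ _

open SimpleGraph in
theorem altW_supp {V : Type*} [DecidableEq V] {G : SimpleGraph V} {u v : V} (p : G.Walk u v)
    (q : Finset V) (h : altW p q ≠ 0) : ∃ x y, q = {x, y} ∧ s(x, y) ∈ p.edges := by
  induction p with
  | nil => simp [altW] at h
  | @cons u w v hadj p ih =>
    by_cases hq : q = {u, w}
    · exact ⟨u, w, hq, by simp⟩
    · simp [altW, hq] at h
      obtain ⟨x, y, h1, h2⟩ := ih h
      exact ⟨x, y, h1, by simp [h2]⟩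

open SimpleGraph in
theorem altW_vals {V : Type*} [DecidableEq V] {G : SimpleGraph V} {u v : V} (p : G.Walk u v)
    (hp : p.IsTrail) (q : Finset V) : altW p q = 0 ∨ altW p q = 1 ∨ altW p q = -1 := by
  induction p with
  | nil => simp [altW]
  | @cons u w v hadj p ih =>
    rw [Walk.isTrail_cons] at hp
    by_cases hq : q = {u, w}
    · have : altW p q = 0 := by
        by_contra h
        obtain ⟨x, y, h1, h2⟩ := altW_supp p q h
        rw [hq, pair_eq_iff'] at h1
        exact hp.2 (h1 ▸ h2)
      simp [altW, hq] at this ⊢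
      simp [this]
    · have := ih hp.1
      simp [altW, hq]
      omega

open SimpleGraph in
theorem altW_ne {V : Type*} [DecidableEq V] {G : SimpleGraph V} {u v : V} (p : G.Walk u v)
    (hp : p.IsTrail) (hl : 0 < p.length) : ∃ q, altW p q ≠ 0 := by
  cases p with
  | nil => simp at hl
  | @cons _ w _ hadj p =>
    rw [Walk.isTrail_cons] at hp
    refine ⟨{u, w}, ?_⟩
    have : altW p {u, w} = 0 := by
      by_contra h
      obtain ⟨x, y, h1, h2⟩ := altW_supp p _ h
      rw [pair_eq_iff'] at h1
      exact hp.2 (h1 ▸ h2)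
    simp [altW, this]

open SimpleGraph in
theorem altW_sum {V : Type*} [DecidableEq V] [Fintype V] {G : SimpleGraph V} {u v : V}
    (p : G.Walk u v) (x : V) :
    ∑ y, altW p {x, y} =
      (if x = u then 1 else 0) - (-1) ^ p.length * (if x = v then 1 else 0) := by
  induction p with
  | nil => simp [altW]
  | @cons u w v hadj p ih =>
    simp only [altW, Finset.sum_sub_distrib, ih]
    have : ∑ y, (if ({x, y} : Finset V) = {u, w} then (1 : ℤ) else 0) =
        (if x = u then 1 else 0) + (if x = w then 1 else 0) := by
      have hne := hadj.ne
      have : ∀ y, (if ({x, y} : Finset V) = {u, w} then (1 : ℤ) else 0) =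
        (if y = w then (if x = u then 1 else 0) else 0) +
        (if y = u then (if x = w then 1 else 0) else 0) := by
        intro y
        simp only [pair_eq_iff', Sym2.eq_iff]
        grind
      simp only [this, Finset.sum_add_distrib, Finset.sum_ite_eq', Finset.mem_univ, if_true]
    rw [this, Walk.length_cons, pow_succ]
    ring

theorem sum_triples {v : ℕ} (g : Finset (Fin v) → ℤ) (i j : Fin v) (hij : i ≠ j) :
    ∑ t ∈ (fullDesignOn (Finset.univ : Finset (Fin v)) 3).filter (fun t => i ∈ t ∧ j ∈ t), g t =
      ∑ k ∈ Finset.univ \ {i, j}, g {i, j, k} := by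
  symm
  refine Finset.sum_bij (fun k _ => {i, j, k}) ?_ ?_ ?_ ?_
  · intro k hk
    simp at hk
    simp only [fullDesignOn, Finset.mem_filter, Finset.mem_powersetCard]
    refine ⟨⟨Finset.subset_univ _, ?_⟩, by simp, by simp⟩
    rw [Finset.card_eq_three]
    exact ⟨i, j, k, hij, by grind, by grind, rfl⟩
  · intro k hk l hl h
    have : k ∈ ({i, j, l} : Finset (Fin v)) := by rw [← h]; simp
    simp at this hk hl
    grind
  · intro t ht
    simp only [fullDesignOn, Finset.mem_filter, Finset.mem_powersetCard] at ht
    obtain ⟨⟨-, hc⟩, hi, hj⟩ := ht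
    have h1 : ((t.erase i).erase j).card = 1 := by
      rw [Finset.card_erase_of_mem (by simp [hj, hij.symm]), Finset.card_erase_of_mem hi, hc]
    obtain ⟨k, hk⟩ := Finset.card_eq_one.1 h1
    have hkm : k ∈ (t.erase i).erase j := by rw [hk]; simp
    simp at hkm
    refine ⟨k, by simp; grind, ?_⟩
    ext x
    have : x ∈ (t.erase i).erase j ↔ x = k := by rw [hk]; simp
    simp at this ⊢
    grind
  · intros; rfl

theorem not_defining_of_weight (v : ℕ) (D : Finset (Finset (Fin v)))
    (a b : Fin v) (hab : a ≠ b) (W : Finset (Fin v) → ℤ)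
    (hsupp : ∀ q, W q ≠ 0 → q.card = 2 ∧ a ∉ q ∧ b ∉ q ∧ insert a q ∉ D ∧ insert b q ∉ D)
    (hvals : ∀ q, W q = 0 ∨ W q = 1 ∨ W q = -1) (hne : ∃ q, W q ≠ 0)
    (hsum : ∀ x, ∑ y, W {x, y} = 0) :
    ¬ IsDefiningSetOn (Finset.univ : Finset (Fin v)) 3 D := by
  rintro ⟨hD, hdef⟩
  have hWa : ∀ q, a ∈ q → W q = 0 := fun q h => by
    by_contra h'; exact (hsupp q h').2.1 h
  have hWb : ∀ q, b ∈ q → W q = 0 := fun q h => by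
    by_contra h'; exact (hsupp q h').2.2.1 h
  let f : Finset (Fin v) → ℤ := fun t =>
    (if a ∈ t then W (t.erase a) else 0) - (if b ∈ t then W (t.erase b) else 0)
  have hf : ∀ t, -1 ≤ f t := by
    intro t
    simp only [f]
    by_cases h1 : a ∈ t <;> by_cases h2 : b ∈ t
    · have e1 : W (t.erase a) = 0 := hWb _ (by simp [h2, hab.symm])
      have e2 : W (t.erase b) = 0 := hWa _ (by simp [h1, hab])
      simp [e1, e2]
    · simp [h1, h2]; have := hvals (t.erase a); omega
    · simp [h1, h2]; have := hvals (t.erase b); omega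
    · simp [h1, h2]
  let m : Finset (Fin v) → ℕ := fun t => (1 + f t).toNat
  have hm : ∀ t, (m t : ℤ) = 1 + f t := fun t => by
    have := hf t
    simp only [m]; omega
  let X := fullDesignOn (Finset.univ : Finset (Fin v)) 3
  let B : Multiset (Finset (Fin v)) := ∑ t ∈ X, m t • {t}
  have hcount : ∀ t ∈ X, B.count t = m t := by
    intro t ht
    simp only [B, Multiset.count_sum', Multiset.count_nsmul, Multiset.count_singleton]
    simp [ht]
  have hdes : IsDesignOn (Finset.univ : Finset (Fin v)) 3
      (((Finset.univ : Finset (Fin v)).card - 2).choose (3 - 2)) B := by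
    constructor
    · intro t ht
      simp only [B, Multiset.mem_sum] at ht
      obtain ⟨s, hs, hts⟩ := ht
      have : t = s := by
        have := Multiset.mem_of_mem_nsmul hts
        simpa using this
      subst this
      simpa [X, fullDesignOn, Finset.mem_powersetCard] using hs
    · intro i _ j _ hij
      have e1 : Multiset.countP (fun t => i ∈ t ∧ j ∈ t) B =
          ∑ t ∈ X.filter (fun t => i ∈ t ∧ j ∈ t), m t := by
        rw [← Multiset.coe_countPAddMonoidHom]
        simp only [B, map_sum, map_nsmul, Finset.sum_filter]
        refine Finset.sum_congr rfl fun t _ => ?_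
        simp only [Multiset.coe_countPAddMonoidHom, ← Multiset.cons_zero, Multiset.countP_cons,
          Multiset.countP_zero]
        split_ifs <;> simp
      rw [e1]
      zify
      rw [Finset.sum_congr rfl (fun t _ => hm t), sum_triples _ i j hij, Finset.sum_add_distrib]
      have hz : ∑ k ∈ Finset.univ \ {i, j}, f {i, j, k} = 0 := by
        have hA : ∀ x, x ≠ a → x ≠ b → ∑ k ∈ Finset.univ \ {a, x}, f {a, x, k} = 0 := by
          intro x hxa hxb
          rw [← hsum x, ← Finset.sum_sdiff (Finset.subset_univ ({a, x} : Finset (Fin v)))]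
          have z : ∑ y ∈ {a, x}, W {x, y} = 0 := by
            rw [Finset.sum_pair hxa.symm, hWa _ (by simp)]
            have : W {x, x} = 0 := by
              by_contra h
              have := (hsupp _ h).1
              simp at this
            rw [this, add_zero]
          rw [z, add_zero]
          refine Finset.sum_congr rfl fun k hk => ?_
          simp at hk
          have e : ({a, x, k} : Finset (Fin v)).erase a = {x, k} := by
            rw [Finset.erase_insert]; simp; grind
          have e2 : W (({a, x, k} : Finset (Fin v)).erase b) = 0 := hWa _ (by simp [hab])
          simp only [f, e, e2]
          simp
        have hB : ∀ x, x ≠ a → x ≠ b → ∑ k ∈ Finset.univ \ {b, x}, f {b, x, k} = 0 := by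
          intro x hxa hxb
          rw [← neg_eq_zero, ← Finset.sum_neg_distrib, ← hsum x,
            ← Finset.sum_sdiff (Finset.subset_univ ({b, x} : Finset (Fin v)))]
          have z : ∑ y ∈ {b, x}, W {x, y} = 0 := by
            rw [Finset.sum_pair hxb.symm, hWb _ (by simp)]
            have : W {x, x} = 0 := by
              by_contra h
              have := (hsupp _ h).1
              simp at this
            rw [this, add_zero]
          rw [z, add_zero]
          refine Finset.sum_congr rfl fun k hk => ?_
          simp at hk
          have e : ({b, x, k} : Finset (Fin v)).erase b = {x, k} := by
            rw [Finset.erase_insert]; simp; grind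
          have e2 : W (({b, x, k} : Finset (Fin v)).erase a) = 0 := hWb _ (by simp [hab.symm])
          simp only [f, e, e2]
          simp
        have hAB : ∀ t, a ∈ t → b ∈ t → f t = 0 := by
          intro t h1 h2
          have e1 : W (t.erase a) = 0 := hWb _ (by simp [h2, hab.symm])
          have e2 : W (t.erase b) = 0 := hWa _ (by simp [h1, hab])
          simp [f, e1, e2]
        have hswap : ∑ k ∈ Finset.univ \ {i, j}, f {i, j, k} =
            ∑ k ∈ Finset.univ \ {j, i}, f {j, i, k} := by
          rw [Finset.pair_comm i j]
          refine Finset.sum_congr rfl fun k _ => ?_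
          rw [Finset.insert_comm]
        by_cases hia : i = a
        · subst hia
          by_cases hjb : j = b
          · subst hjb
            exact Finset.sum_eq_zero fun k _ => hAB _ (by simp) (by simp)
          · exact hA j hij.symm hjb
        · by_cases hib : i = b
          · subst hib
            by_cases hja : j = a
            · subst hja
              exact Finset.sum_eq_zero fun k _ => hAB _ (by simp) (by simp)
            · exact hB j hja hij.symm
          · by_cases hja : j = a
            · subst hja
              rw [hswap]; exact hA i hia hib
            · by_cases hjb : j = b
              · subst hjb
                rw [hswap]; exact hB i hia hib
              · have hk : ∀ k, f {i, j, k} =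
                    (if k = a then W {i, j} else 0) - (if k = b then W {i, j} else 0) := by
                  intro k
                  have g : ∀ c, i ≠ c → j ≠ c → ({i, j, c} : Finset (Fin v)).erase c = {i, j} := by
                    intro c h1 h2
                    ext y; simp; grind
                  by_cases hka : k = a
                  · subst hka
                    have : b ∉ ({i, j, k} : Finset (Fin v)) := by simp; grind
                    simp only [f, this, g k hia hja]
                    simp [hab]
                  · by_cases hkb : k = b
                    · subst hkb
                      have : a ∉ ({i, j, k} : Finset (Fin v)) := by simp; grind
                      simp only [f, this, g k hib hjb]
                      simp [hab.symm]
                    · have h1 : b ∉ ({i, j, k} : Finset (Fin v)) := by simp; grind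
                      have h2 : a ∉ ({i, j, k} : Finset (Fin v)) := by simp; grind
                      simp only [f, h1, h2, hka, hkb, if_false]
                simp only [hk, Finset.sum_sub_distrib, Finset.sum_ite_eq']
                have h1 : a ∈ Finset.univ \ ({i, j} : Finset (Fin v)) := by simp; grind
                have h2 : b ∈ Finset.univ \ ({i, j} : Finset (Fin v)) := by simp; grind
                rw [if_pos h1, if_pos h2, sub_self]
      rw [hz, add_zero, Finset.sum_const, Finset.card_sdiff_of_subset (Finset.subset_univ _),
        Finset.card_pair hij]
      simp
  have hle : D.val ≤ B := by
    rw [Multiset.le_iff_count]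
    intro t
    by_cases ht : t ∈ D
    · have h1 : D.val.count t = 1 := Multiset.count_eq_one_of_mem D.nodup ht
      rw [h1, hcount t (hD ht)]
      have : f t = 0 := by
        have h1 : a ∈ t → W (t.erase a) = 0 := by
          intro h
          by_contra h'
          have := (hsupp _ h').2.2.2.1
          rw [Finset.insert_erase h] at this
          exact this ht
        have h2 : b ∈ t → W (t.erase b) = 0 := by
          intro h
          by_contra h'
          have := (hsupp _ h').2.2.2.2
          rw [Finset.insert_erase h] at this
          exact this ht
        simp only [f]
        split_ifs <;> simp_all
      have := hm t
      omega
    · rw [Multiset.count_eq_zero_of_notMem (by simpa using ht)]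
      exact Nat.zero_le _
  have heq := hdef B hdes hle
  obtain ⟨q, hq⟩ := hne
  obtain ⟨hq2, hqa, hqb, -, -⟩ := hsupp q hq
  have hX : insert a q ∈ X := by
    simp [X, fullDesignOn, Finset.mem_powersetCard, Finset.card_insert_of_notMem hqa, hq2]
  have h1 := hcount _ hX
  rw [heq, Multiset.count_eq_one_of_mem (Finset.nodup _) hX] at h1
  have h2 := hm (insert a q)
  have h3 : f (insert a q) = W q := by
    have : b ∉ insert a q := by simp [hab.symm, hqb]
    simp only [f, this, Finset.erase_insert hqa]
    simp
  rw [← h1, h3] at h2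
  apply hq
  push_cast at h2
  omega

/-- Let `v ≥ 4` and let `D` be a subset of the full design `F(v,3)`. If there are distinct
points `a, b` with `s_{a,b}(D) > ⌊(4v−11)/3⌋`, then `D` is not a defining set for `F(v,3)`. -/
theorem not_definingSet_of_sPair_large (v : ℕ) (hv : 4 ≤ v)
    (D : Finset (Finset (Fin v))) (hD : D ⊆ fullDesignOn Finset.univ 3)
    (a b : Fin v) (hab : a ≠ b) (h : (4 * v - 11) / 3 < sPair D a b) :
    ¬ IsDefiningSetOn (Finset.univ : Finset (Fin v)) 3 D := by
  classical
  let G : SimpleGraph (Fin v) := 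
    { Adj := fun i j => i ≠ j ∧ i ∉ ({a, b} : Finset (Fin v)) ∧ j ∉ ({a, b} : Finset (Fin v)) ∧
        insert a {i, j} ∉ D ∧ insert b {i, j} ∉ D
      symm := ⟨fun i j ⟨h1, h2, h3, h4, h5⟩ => ⟨h1.symm, h3, h2, by rwa [Finset.pair_comm],
        by rwa [Finset.pair_comm]⟩⟩
      loopless := ⟨fun i h => h.1 rfl⟩ }
  let V := {x : Fin v // x ∉ ({a, b} : Finset (Fin v))}
  have hcV : Fintype.card V = v - 2 := by
    rw [Fintype.card_subtype_compl, Fintype.card_coe, Finset.card_pair hab, Fintype.card_fin]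
  have : Nonempty V := Fintype.card_pos_iff.1 (by omega)
  let f : V ↪ Fin v := Function.Embedding.subtype _
  let G' : SimpleGraph V := G.comap f
  have hle : sPair D a b ≤ G'.edgeFinset.card := by
    unfold sPair
    refine le_trans (Finset.card_le_card (t := G'.edgeFinset.image
      (fun e => e.lift ⟨fun x y => ({x.1, y.1} : Finset (Fin v)), 
        fun x y => Finset.pair_comm _ _⟩)) ?_) Finset.card_image_le
    intro q hq
    simp only [Finset.mem_filter, Finset.mem_powersetCard] at hq
    obtain ⟨⟨hsub, hc⟩, h1, h2⟩ := hq
    obtain ⟨x, y, hxy, rfl⟩ := Finset.card_eq_two.1 hc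
    have hx : x ∉ ({a, b} : Finset (Fin v)) := (Finset.mem_sdiff.1 (hsub (by simp))).2
    have hy : y ∉ ({a, b} : Finset (Fin v)) := (Finset.mem_sdiff.1 (hsub (by simp))).2
    rw [Finset.mem_image]
    refine ⟨s(⟨x, hx⟩, ⟨y, hy⟩), ?_, rfl⟩
    rw [SimpleGraph.mem_edgeFinset, SimpleGraph.mem_edgeSet]
    exact ⟨hxy, hx, hy, h1, h2⟩
  obtain ⟨z, d, hd, hdl, hde⟩ := exists_even_trail G' (by omega)
  let φ : G' →g G := ⟨f, fun h => h⟩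
  let d' := d.map φ
  have hd' : d'.IsTrail := (SimpleGraph.Walk.isTrail_map_iff_of_injective f.injective).2 hd
  have hl' : d'.length = d.length := by simp [d']
  refine not_defining_of_weight v D a b hab (altW d') ?_ (altW_vals d' hd')
    (altW_ne d' hd' (by omega)) ?_
  · intro q hq
    obtain ⟨x, y, rfl, he⟩ := altW_supp d' q hq
    obtain ⟨h1, h2, h3, h4, h5⟩ : G.Adj x y := d'.edges_subset_edgeSet he
    simp only [Finset.mem_insert, Finset.mem_singleton] at h2 h3
    refine ⟨Finset.card_pair h1, ?_, ?_, h4, h5⟩ <;> simp <;> grind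
  · intro x
    rw [altW_sum, hl', hde.neg_one_pow]
    ring
end

section
/- Let v ≥ 4 and let D be a subset of the full design F(v,3). For each unordered pair {i,j} of distinct points of {1,…,v}, let x_{i,j} be the number of triples in D containing both i and j. Then Σ_{{i,j}⊂{1,…,v}} (v−2−x_{i,j})(v−3−x_{i,j})/2 = Σ_{{a,b}⊂{1,…,v}} s_{a,b}(D), where both sums range over all unordered pairs of distinct points. -/
/-- For an unordered pair `p = {a,b}` of points, `s_p(D)` is the number of unordered pairs
`{i,j}` of points outside `p` such that neither `{i,j,a}` nor `{i,j,b}` belongs to `D`. -/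
def sPairSet {α : Type*} [DecidableEq α] [Fintype α] (D : Finset (Finset α))
    (p : Finset α) : ℕ :=
  (((Finset.univ \ p).powersetCard 2).filter
    (fun q => ∀ x ∈ p, insert x q ∉ D)).card

/-- For an unordered pair `p = {i,j}` of points, `x_p(D)` is the number of triples of `D`
containing both `i` and `j`. -/
def xPair {α : Type*} [DecidableEq α] (D : Finset (Finset α)) (p : Finset α) : ℕ :=
  (D.filter (fun b => p ⊆ b)).card

/-- Points outside `q` completing `q` to a triple missing from `D`. -/
def missPts {v : ℕ} (D : Finset (Finset (Fin v))) (q : Finset (Fin v)) : Finset (Fin v) :=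
  (Finset.univ \ q).filter (fun x => insert x q ∉ D)

theorem card_missPts {v : ℕ} (D : Finset (Finset (Fin v)))
    (hD : D ⊆ fullDesignOn Finset.univ 3) (q : Finset (Fin v)) (hq : q.card = 2) :
    (missPts D q).card + xPair D q + 2 = v := by
  have h1 : ((Finset.univ \ q).filter (fun x => insert x q ∈ D)).card = xPair D q := by
    unfold xPair
    apply Finset.card_bij (fun x _ => insert x q)
    · intro x hx
      simp only [Finset.mem_filter] at hx ⊢
      exact ⟨hx.2, Finset.subset_insert _ _⟩
    · intro x hx y hy h
      simp only [Finset.mem_filter, Finset.mem_sdiff, Finset.mem_univ, true_and] at hx hy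
      exact (Finset.insert_inj hx.1).1 h
    · intro b hb
      simp only [Finset.mem_filter] at hb
      have hb3 : b.card = 3 := (Finset.mem_powersetCard.1 (hD hb.1)).2
      have hc : (b \ q).card = 1 := by
        rw [Finset.card_sdiff_of_subset hb.2]; omega
      obtain ⟨x, hx⟩ := Finset.card_eq_one.1 hc
      have hxm : x ∈ b \ q := by rw [hx]; simp
      have e : insert x q = b := by
        rw [Finset.insert_eq, ← hx, Finset.sdiff_union_of_subset hb.2]
      refine ⟨x, ?_, e⟩
      simp only [Finset.mem_filter, e]
      simp only [Finset.mem_sdiff] at hxm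
      simp [hxm.2, hb.1]
  have h2 := Finset.card_filter_add_card_filter_not (s := Finset.univ \ q)
    (fun x => insert x q ∈ D)
  have h3 := Finset.card_sdiff_add_card_eq_card (Finset.subset_univ q)
  rw [Finset.card_univ, Fintype.card_fin] at h3
  unfold missPts
  omega

theorem sum_sPair_eq {v : ℕ} (D : Finset (Finset (Fin v))) :
    ∑ p ∈ (Finset.univ : Finset (Fin v)).powersetCard 2, sPairSet D p =
    ∑ q ∈ (Finset.univ : Finset (Fin v)).powersetCard 2, (missPts D q).card.choose 2 := by
  have h := Finset.sum_card_bipartiteAbove_eq_sum_card_bipartiteBelow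
    (s := (Finset.univ : Finset (Fin v)).powersetCard 2)
    (t := (Finset.univ : Finset (Fin v)).powersetCard 2)
    (fun p q => ∀ x ∈ p, x ∉ q ∧ insert x q ∉ D)
  convert h using 2 with p hp q hq
  · unfold sPairSet Finset.bipartiteAbove
    congr 1
    ext q
    simp only [Finset.mem_filter, Finset.mem_powersetCard, Finset.subset_univ, true_and]
    constructor
    · rintro ⟨⟨h1, h2⟩, h3⟩
      exact ⟨h2, fun x hx => ⟨fun hxq => (Finset.mem_sdiff.1 (h1 hxq)).2 hx, h3 x hx⟩⟩
    · rintro ⟨h1, h2⟩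
      exact ⟨⟨fun x hx => Finset.mem_sdiff.2 ⟨Finset.mem_univ _, fun hxp => (h2 x hxp).1 hx⟩,
        h1⟩, fun x hx => (h2 x hx).2⟩
  · rw [← Finset.card_powersetCard]
    unfold Finset.bipartiteBelow
    congr 1
    ext p
    simp only [Finset.mem_filter, Finset.mem_powersetCard, Finset.subset_univ, true_and,
      missPts, Finset.subset_iff, Finset.mem_sdiff, Finset.mem_univ]
    tauto

/-- Let `v ≥ 4` and `D ⊆ F(v,3)`. Then
`Σ_{{i,j}} (v−2−x_{i,j})(v−3−x_{i,j})/2 = Σ_{{a,b}} s_{a,b}(D)`, both sums ranging over all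
unordered pairs of distinct points of `{1,…,v}`. -/
theorem sum_missing_pairs_eq_sum_sPair (v : ℕ) (hv : 4 ≤ v)
    (D : Finset (Finset (Fin v))) (hD : D ⊆ fullDesignOn Finset.univ 3) :
    ∑ p ∈ (Finset.univ : Finset (Fin v)).powersetCard 2,
        ((v : ℝ) - 2 - xPair D p) * ((v : ℝ) - 3 - xPair D p) / 2 =
      ∑ p ∈ (Finset.univ : Finset (Fin v)).powersetCard 2, (sPairSet D p : ℝ) := by
  rw [← Nat.cast_sum, sum_sPair_eq, Nat.cast_sum]
  refine Finset.sum_congr rfl fun q hq => ?_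
  have h := card_missPts D hD q (Finset.mem_powersetCard.1 hq).2
  have h' : (v : ℝ) = (missPts D q).card + xPair D q + 2 := by exact_mod_cast h.symm
  rw [Nat.cast_choose_two, h']
  ring
end

section
/- Let v ≥ 4 and let D be a defining set for the full design F(v,3). Then |D| ≥ v(v−1)(v − 5/2 − √((32v−85)/12))/6. -/
open Finset in
theorem trail_alternating {V : Type*} [DecidableEq V] {G : SimpleGraph V} {u w : V}
    (p : G.Walk u w) (hp : p.IsTrail) :
    ∃ A B : Finset (Sym2 V), Disjoint A B ∧ A ∪ B = p.edges.toFinset ∧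
      (p.length ≠ 0 → A.Nonempty) ∧
      ∀ x, (#{e ∈ A | x ∈ e} : ℤ) - #{e ∈ B | x ∈ e} =
        (if x = u then 1 else 0) - (-1) ^ p.length * (if x = w then 1 else 0) := by
  induction p with
  | nil => exact ⟨∅, ∅, by simp⟩
  | @cons u t w h p ih =>
    rw [SimpleGraph.Walk.isTrail_cons] at hp
    obtain ⟨A, B, hd, hu, -, hx⟩ := ih hp.1
    have hn : s(u, t) ∉ A ∪ B := by rw [hu]; simpa using hp.2
    rw [mem_union, not_or] at hn
    refine ⟨insert s(u, t) B, A, ?_, ?_, by simp, ?_⟩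
    · rw [disjoint_insert_left]; exact ⟨hn.1, hd.symm⟩
    · rw [insert_union, union_comm, hu]; simp
    · intro x
      have h1 := hx x
      have hne := h.ne
      rw [filter_insert]
      have h2 : (#(if x ∈ s(u, t) then insert s(u, t) {e ∈ B | x ∈ e} else {e ∈ B | x ∈ e}) : ℤ)
          = #{e ∈ B | x ∈ e} + (if x = u then 1 else 0) + (if x = t then 1 else 0) := by
        split_ifs with h3 h4 h5 h6 h7 h8
        · grind
        · rw [card_insert_of_notMem (by simp [hn.2])]; simp
        · rw [card_insert_of_notMem (by simp [hn.2])]; simp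
        · simp_all
        · simp_all
        · simp_all
        · simp_all
        · simp
      rw [h2, SimpleGraph.Walk.length_cons, pow_succ]
      linarith

theorem first_return {V : Type*} {G : SimpleGraph V} {c0 : V} (c : G.Walk c0 c0) {w z : V}
    (p : G.Walk w z) (hp : p.IsTrail) (hz : z ∈ c.support) :
    ∃ z' ∈ c.support, ∃ q : G.Walk w z', q.IsTrail ∧ q.edges ⊆ p.edges ∧
      q.edges.Disjoint c.edges := by
  induction p with
  | nil => exact ⟨_, hz, .nil, by simp⟩
  | @cons w t z h p ih =>
    by_cases hw : w ∈ c.support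
    · exact ⟨w, hw, .nil, by simp⟩
    rw [SimpleGraph.Walk.isTrail_cons] at hp
    obtain ⟨z', hz', q, hq, hs, hd⟩ := ih hp.1 hz
    refine ⟨z', hz', .cons h q, ?_, ?_, ?_⟩
    · rw [SimpleGraph.Walk.isTrail_cons]; exact ⟨hq, fun h => hp.2 (hs h)⟩
    · rw [SimpleGraph.Walk.edges_cons, SimpleGraph.Walk.edges_cons]
      exact List.cons_subset_cons _ hs
    · rw [SimpleGraph.Walk.edges_cons, List.disjoint_cons_left]
      exact ⟨fun h => hw (c.fst_mem_support_of_mem_edges h), hd⟩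

theorem exists_ear {V : Type*} {G : SimpleGraph V} {c0 : V} (c : G.Walk c0 c0) {w z : V}
    (p : G.Walk w z) (hp : p.IsTrail) (hw : w ∈ c.support) (hz : z ∈ c.support)
    (he : ∃ e ∈ p.edges, e ∉ c.edges) :
    ∃ y ∈ c.support, ∃ z' ∈ c.support, ∃ q : G.Walk y z', q.IsTrail ∧ q.length ≠ 0 ∧
      q.edges.Disjoint c.edges := by
  induction p with
  | nil => simp at he
  | @cons w t z h p ih =>
    rw [SimpleGraph.Walk.isTrail_cons] at hp
    by_cases hc : s(w, t) ∈ c.edges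
    · refine ih hp.1 (c.snd_mem_support_of_mem_edges hc) hz ?_
      obtain ⟨e, he, hec⟩ := he
      rw [SimpleGraph.Walk.edges_cons, List.mem_cons] at he
      rcases he with rfl | he
      · exact absurd hc hec
      · exact ⟨e, he, hec⟩
    · obtain ⟨z', hz', q, hq, hs, hd⟩ := first_return c p hp.1 hz
      refine ⟨w, hw, z', hz', .cons h q, ?_, by simp, ?_⟩
      · rw [SimpleGraph.Walk.isTrail_cons]; exact ⟨hq, fun h => hp.2 (hs h)⟩
      · rw [SimpleGraph.Walk.edges_cons, List.disjoint_cons_left]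
        exact ⟨hc, hd⟩

theorem even_of_ear {V : Type*} [DecidableEq V] {G : SimpleGraph V}
    (hG : ∀ u, ∀ p : G.Walk u u, p.IsTrail → Even p.length → p.length = 0)
    {c0 : V} (c : G.Walk c0 c0) (hc : c.IsTrail) (hodd : ¬ Even c.length) {y z : V}
    (hy : y ∈ c.support) (hz : z ∈ c.support) (q : G.Walk y z) (hq : q.IsTrail)
    (hl : q.length ≠ 0) (hd : q.edges.Disjoint c.edges) : False := by
  have hz' : z ∈ (c.rotate y hy).support := by simpa using hz
  have hc' : (c.rotate y hy).IsTrail := by simpa using hc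
  have hlen : (c.rotate y hy).length = c.length := by simp
  have hd' : q.edges.Disjoint (c.rotate y hy).edges := fun e h1 h2 =>
    hd h1 ((c.rotate_edges y hy).mem_iff.1 h2)
  generalize c.rotate y hy = d at *
  have hspec := d.take_spec hz'
  have hl2 := congrArg SimpleGraph.Walk.length hspec
  have he2 := congrArg SimpleGraph.Walk.edges hspec
  rw [SimpleGraph.Walk.length_append] at hl2
  rw [SimpleGraph.Walk.edges_append] at he2
  have ht1 := hc'.takeUntil hz'
  have ht2 := hc'.dropUntil hz'
  generalize d.takeUntil z hz' = a at *
  generalize d.dropUntil z hz' = b at *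
  by_cases hev : Even (a.length + q.length)
  · have := hG _ (a.append q.reverse) (by
      rw [SimpleGraph.Walk.isTrail_append]
      refine ⟨ht1, by simpa using hq, ?_⟩
      intro e h1 h2
      refine hd' (by simpa using h2) ?_
      rw [← he2]; simp [h1]) (by simpa using hev)
    rw [SimpleGraph.Walk.length_append, SimpleGraph.Walk.length_reverse] at this; omega
  · have := hG _ (b.append q) (by
      rw [SimpleGraph.Walk.isTrail_append]
      refine ⟨ht2, by simpa using hq, ?_⟩
      intro e h1 h2
      refine hd' (by simpa using h2) ?_
      rw [← he2]; simp [h1]) (by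
      rw [SimpleGraph.Walk.length_append]; grind)
    rw [SimpleGraph.Walk.length_append] at this; omega

theorem acyclic_bound {V : Type*} [Fintype V] [Nonempty V] (G : SimpleGraph V)
    (hG : G.IsAcyclic) : G.edgeSet.ncard + 1 ≤ Fintype.card V := by
  classical
  obtain ⟨F, h1, -, h2⟩ := SimpleGraph.connected_top.exists_isTree_le_of_le_of_isAcyclic
    (le_top : G ≤ ⊤) hG
  rw [← h2.card_edgeFinset, ← SimpleGraph.coe_edgeFinset, Set.ncard_coe_finset]
  have := Finset.card_le_card (SimpleGraph.edgeFinset_mono h1)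
  omega

theorem edge_bound_aux {V : Type*} [Fintype V] [DecidableEq V] [Nonempty V] (m : ℕ) :
    ∀ (G : SimpleGraph V) (S : Finset V), G.edgeSet.ncard = m →
    (∀ u, ∀ p : G.Walk u u, p.IsTrail → Even p.length → p.length = 0) →
    (∀ u, ∀ p : G.Walk u u, p.IsCycle → ∀ x ∈ p.support, x ∉ S) →
    3 * m + 3 + S.card ≤ 4 * Fintype.card V := by
  induction m with
  | zero =>
    intro G S _ _ _
    have := S.card_le_univ
    have := Fintype.card_pos (α := V)
    omega
  | succ m ih =>
    intro G S hm hG hS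
    by_cases hac : G.IsAcyclic
    · have := acyclic_bound G hac
      have := S.card_le_univ
      omega
    obtain ⟨c0, c, hc, hgirth⟩ := SimpleGraph.exists_girth_eq_length.2 hac
    have hodd : ¬ Even c.length := fun h => by
      have := hG _ c hc.isTrail h
      have := hc.three_le_length
      omega
    obtain ⟨e, he⟩ : ∃ e, e ∈ c.edges := by
      apply List.exists_mem_of_length_pos
      have := hc.three_le_length
      simp; omega
    have heG : e ∈ G.edgeSet := c.edges_subset_edgeSet he
    have hle : G.deleteEdges {e} ≤ G := G.deleteEdges_le {e}
    have hcard : 3 ≤ c.support.toFinset.card := by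
      have h1 : c.support.tail.toFinset.card = c.length := by
        rw [List.toFinset_card_of_nodup hc.support_nodup]; simp
      have h2 : c.support.tail.toFinset.card ≤ c.support.toFinset.card :=
        Finset.card_le_card (fun x hx => by
          rw [List.mem_toFinset] at *; exact List.mem_of_mem_tail hx)
      have := hc.three_le_length
      omega
    have hdisj : Disjoint S c.support.toFinset := by
      rw [Finset.disjoint_right]
      intro x hx
      exact hS _ c hc x (by simpa using hx)
    have := ih (G.deleteEdges {e}) (S ∪ c.support.toFinset) ?_ ?_ ?_
    · rw [Finset.card_union_of_disjoint hdisj] at this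
      omega
    · rw [SimpleGraph.edgeSet_deleteEdges, Set.ncard_sdiff_singleton_of_mem heG, hm]
      rfl
    · intro u p hp hev
      have := hG u (p.mapLe hle) (by simpa using hp) (by simpa using hev)
      simpa using this
    · intro u p hp x hx hxS
      have hp' : (p.mapLe hle).IsCycle := by simpa using hp
      have hx' : x ∈ (p.mapLe hle).support := by simpa using hx
      have hep : e ∉ (p.mapLe hle).edges := by
        intro h
        have h' : e ∈ p.edges := by simpa using h
        have := p.edges_subset_edgeSet h'
        rw [SimpleGraph.edgeSet_deleteEdges] at this
        exact this.2 rfl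
      generalize p.mapLe hle = q at *
      rw [Finset.mem_union] at hxS
      rcases hxS with hxS | hxS
      · exact hS _ q hp' x hx' hxS
      rw [List.mem_toFinset] at hxS
      have hex : ∃ f ∈ (q.rotate x hx').edges, f ∉ c.edges := by
        by_contra! hcon
        have hsub : q.edges.toFinset ⊆ c.edges.toFinset.erase e := by
          intro f hf
          rw [List.mem_toFinset] at hf
          rw [Finset.mem_erase, List.mem_toFinset]
          exact ⟨fun h => hep (h ▸ hf), hcon f ((q.rotate_edges x hx').mem_iff.2 hf)⟩
        have h1 := Finset.card_le_card hsub
        rw [Finset.card_erase_of_mem (by simpa using he),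
          List.toFinset_card_of_nodup hp'.isTrail.edges_nodup,
          List.toFinset_card_of_nodup hc.isTrail.edges_nodup] at h1
        have h2 := SimpleGraph.girth_le_length hp'
        have := hc.three_le_length
        simp at h1
        omega
      obtain ⟨y, hy, z, hz, r, hr, hl, hd⟩ :=
        exists_ear c (q.rotate x hx') (by simpa using hp'.isTrail) hxS hxS hex
      exact even_of_ear hG c hc.isTrail hodd hy hz r hr hl hd

open Finset in
theorem edge_bound {V : Type*} [Fintype V] [DecidableEq V] [Nonempty V] (G : SimpleGraph V)
    (hG : ¬ ∃ A B : Finset (Sym2 V), Disjoint A B ∧ (A : Set (Sym2 V)) ⊆ G.edgeSet ∧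
      (B : Set (Sym2 V)) ⊆ G.edgeSet ∧ A.Nonempty ∧
      ∀ x, #{e ∈ A | x ∈ e} = #{e ∈ B | x ∈ e}) :
    3 * G.edgeSet.ncard + 3 ≤ 4 * Fintype.card V := by
  have := edge_bound_aux G.edgeSet.ncard G ∅ rfl ?_ (by simp)
  · simpa using this
  intro u p hp hev
  by_contra hne
  obtain ⟨A, B, hd, hu, hn, hx⟩ := trail_alternating p hp
  have hmem : ∀ e ∈ A ∪ B, e ∈ G.edgeSet := by
    intro e he
    rw [hu, List.mem_toFinset] at he
    exact p.edges_subset_edgeSet he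
  refine hG ⟨A, B, hd, fun e he => hmem e (mem_union_left _ he),
    fun e he => hmem e (mem_union_right _ he), hn hne, fun x => ?_⟩
  have := hx x
  rw [hev.neg_one_pow] at this
  simp at this
  omega

theorem defining_no_trade {α : Type*} [DecidableEq α] (P : Finset α) (k : ℕ)
    (D : Finset (Finset α)) (hD : IsDefiningSetOn P k D)
    (T1 T2 : Multiset (Finset α)) (hn : T1.Nodup)
    (h1 : ∀ t ∈ T1, t ∈ fullDesignOn P k \ D) (h2 : ∀ t ∈ T2, t ∈ fullDesignOn P k)
    (hF : ∀ i ∈ P, ∀ j ∈ P, i ≠ j → Multiset.countP (fun b => i ∈ b ∧ j ∈ b)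
      (fullDesignOn P k).val = (P.card - 2).choose (k - 2))
    (hc : ∀ i ∈ P, ∀ j ∈ P, i ≠ j → Multiset.countP (fun b => i ∈ b ∧ j ∈ b) T1 =
      Multiset.countP (fun b => i ∈ b ∧ j ∈ b) T2) : T1 = T2 := by
  have hle : D.val + T1 ≤ (fullDesignOn P k).val := by
    rw [Multiset.le_iff_subset]
    · intro t ht
      rw [Multiset.mem_add] at ht
      rcases ht with ht | ht
      · exact hD.1 ht
      · exact (Finset.mem_sdiff.1 (h1 t ht)).1
    · rw [Multiset.nodup_add]
      refine ⟨D.nodup, hn, ?_⟩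
      rw [Multiset.disjoint_left]
      intro t ht ht'
      exact (Finset.mem_sdiff.1 (h1 t ht')).2 ht
  have hle1 : T1 ≤ (fullDesignOn P k).val := le_trans (Multiset.le_add_left _ _) hle
  obtain ⟨R, hR⟩ := Multiset.le_iff_exists_add.1 hle1
  have hDR : D.val ≤ R := by
    rw [hR, add_comm] at hle
    exact (Multiset.add_le_add_iff_left).1 hle
  have := hD.2 (T2 + R) ?_ (hDR.trans (Multiset.le_add_left _ _))
  · rw [hR] at this
    exact (Multiset.add_left_inj.1 this).symm
  · refine ⟨?_, ?_⟩
    · intro t ht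
      have ht' : t ∈ fullDesignOn P k := by
        rw [Multiset.mem_add] at ht
        rcases ht with ht | ht
        · exact h2 t ht
        · have : t ∈ (fullDesignOn P k).val := by rw [hR]; simp [ht]
          exact this
      exact Finset.mem_powersetCard.1 ht'
    · intro i hi j hj hij
      rw [Multiset.countP_add, ← hc i hi j hj hij, ← Multiset.countP_add, ← hR]
      exact hF i hi j hj hij

theorem count_full_three (v : ℕ) (i j : Fin v) (hij : i ≠ j) :
    Multiset.countP (fun b => i ∈ b ∧ j ∈ b)
      (fullDesignOn (Finset.univ : Finset (Fin v)) 3).val =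
      ((Finset.univ : Finset (Fin v)).card - 2).choose (3 - 2) := by
  rw [Multiset.countP_eq_card_filter]
  change ((fullDesignOn (Finset.univ : Finset (Fin v)) 3).filter (fun b => i ∈ b ∧ j ∈ b)).card = _
  have h : (fullDesignOn (Finset.univ : Finset (Fin v)) 3).filter (fun b => i ∈ b ∧ j ∈ b) =
      ((Finset.univ : Finset (Fin v)) \ {i, j}).image (fun k => ({i, j, k} : Finset (Fin v))) := by
    ext t
    simp only [fullDesignOn, Finset.mem_filter, Finset.mem_powersetCard, Finset.mem_image,
      Finset.mem_sdiff, Finset.mem_univ, Finset.mem_insert, Finset.mem_singleton, true_and,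
      Finset.subset_univ]
    constructor
    · rintro ⟨hc, hi, hj⟩
      have h1 : ({i, j} : Finset (Fin v)) ⊆ t := by
        intro x hx; simp at hx; rcases hx with rfl | rfl <;> assumption
      have h2 : (t \ {i, j}).card = 1 := by
        rw [Finset.card_sdiff_of_subset h1, hc, Finset.card_pair hij]
      obtain ⟨k, hk⟩ := Finset.card_eq_one.1 h2
      refine ⟨k, ?_, ?_⟩
      · have : k ∈ t \ {i, j} := by rw [hk]; simp
        simpa using (Finset.mem_sdiff.1 this).2
      · ext x
        have := Finset.ext_iff.1 hk x
        simp at this ⊢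
        grind
    · rintro ⟨k, hk, rfl⟩
      refine ⟨?_, by simp, by simp⟩
      rw [Finset.card_eq_three]
      exact ⟨i, j, k, hij, by grind, by grind, rfl⟩
  rw [h, Finset.card_image_of_injOn, Finset.card_sdiff_of_subset (by simp), Finset.card_pair hij]
  · simp
  · intro x hx y hy hxy
    simp at hx hy hxy
    have := Finset.ext_iff.1 hxy x
    simp at this
    grind

theorem pair_bound (v : ℕ) (hv : 4 ≤ v) (D : Finset (Finset (Fin v)))
    (hD : IsDefiningSetOn (Finset.univ : Finset (Fin v)) 3 D) (a b : Fin v) (hab : a ≠ b) :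
    3 * (Finset.univ.filter (fun q : Fin v × Fin v =>
      {a, q.1, q.2} ∈ fullDesignOn (Finset.univ : Finset (Fin v)) 3 \ D ∧
      {b, q.1, q.2} ∈ fullDesignOn (Finset.univ : Finset (Fin v)) 3 \ D)).card + 22 ≤ 8 * v := by
  classical
  set U := fullDesignOn (Finset.univ : Finset (Fin v)) 3 \ D with hU
  have hU3 : ∀ t ∈ U, t.card = 3 := fun t ht =>
    (Finset.mem_powersetCard.1 (Finset.mem_sdiff.1 ht).1).2
  let V := {x : Fin v // x ∉ ({a, b} : Finset (Fin v))}
  have hVcard : Fintype.card V + 2 = v := by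
    have h1 : Fintype.card V = Fintype.card (Fin v) - ({a, b} : Finset (Fin v)).card := by
      rw [← Finset.card_compl, Fintype.card_subtype]
      congr 1
      ext x
      simp
    rw [Finset.card_pair hab, Fintype.card_fin] at h1
    omega
  have : Nonempty V := Fintype.card_pos_iff.1 (by omega)
  let G : SimpleGraph V :=
    { Adj := fun x y => x ≠ y ∧ {a, x.1, y.1} ∈ U ∧ {b, x.1, y.1} ∈ U
      symm := ⟨fun x y h => ⟨h.1.symm, by rw [Finset.pair_comm]; exact h.2.1,
        by rw [Finset.pair_comm]; exact h.2.2⟩⟩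
      loopless := ⟨fun x h => h.1 rfl⟩ }
  let φ : Sym2 V → Finset (Fin v) := fun e => Finset.univ.filter (fun i => ∃ h, (⟨i, h⟩ : V) ∈ e)
  have hφ : ∀ e i, i ∈ φ e ↔ ∃ h, (⟨i, h⟩ : V) ∈ e := by simp [φ]
  have hφa : ∀ e, a ∉ φ e := fun e h => by
    obtain ⟨h, _⟩ := (hφ e a).1 h; simp at h
  have hφb : ∀ e, b ∉ φ e := fun e h => by
    obtain ⟨h, _⟩ := (hφ e b).1 h; simp at h
  have hφinj : Function.Injective φ := by
    intro e f h
    ext x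
    have h1 := Finset.ext_iff.1 h x.1
    rw [hφ, hφ] at h1
    constructor
    · intro hx; exact (h1.1 ⟨x.2, hx⟩).2
    · intro hx; exact (h1.2 ⟨x.2, hx⟩).2
  have hφmk : ∀ x y : V, φ s(x, y) = {x.1, y.1} := by
    intro x y
    ext i
    rw [hφ]
    have hm : i ∈ ({x.1, y.1} : Finset (Fin v)) ↔ i = x.1 ∨ i = y.1 := by simp
    rw [hm]
    constructor
    · rintro ⟨h, h'⟩
      rcases Sym2.mem_iff.1 h' with h | h
      · left; rw [← h]
      · right; rw [← h]
    · rintro (h | h)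
      · exact ⟨h ▸ x.2, Sym2.mem_iff.2 (Or.inl (Subtype.ext h))⟩
      · exact ⟨h ▸ y.2, Sym2.mem_iff.2 (Or.inr (Subtype.ext h))⟩
  have hGU : ∀ e ∈ G.edgeSet, insert a (φ e) ∈ U ∧ insert b (φ e) ∈ U := by
    intro e
    induction e with
    | _ x y =>
      intro h
      rw [hφmk]
      exact h.2
  have hia : Function.Injective (fun e => insert a (φ e)) := by
    intro e f h
    apply hφinj
    have := congrArg (fun s => Finset.erase s a) h
    simpa [Finset.erase_insert (hφa _)] using this
  have hib : Function.Injective (fun e => insert b (φ e)) := by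
    intro e f h
    apply hφinj
    have := congrArg (fun s => Finset.erase s b) h
    simpa [Finset.erase_insert (hφb _)] using this
  have habne : ∀ e f, insert a (φ e) ≠ insert b (φ f) := by
    intro e f h
    have : a ∈ insert b (φ f) := h ▸ Finset.mem_insert_self _ _
    rw [Finset.mem_insert] at this
    exact this.elim hab (hφa f)
  have hmain := edge_bound G (by
    rintro ⟨A, B, hd, hA, hB, ⟨e0, he0⟩, hdeg⟩
    have hT := defining_no_trade Finset.univ 3 D hD
      (A.val.map (fun e => insert a (φ e)) + B.val.map (fun e => insert b (φ e)))
      (A.val.map (fun e => insert b (φ e)) + B.val.map (fun e => insert a (φ e)))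
      ?_ ?_ ?_ (fun i _ j _ hij => count_full_three v i j hij) ?_
    · have h0 : insert a (φ e0) ∈
          A.val.map (fun e => insert b (φ e)) + B.val.map (fun e => insert a (φ e)) := by
        rw [← hT, Multiset.mem_add]
        exact Or.inl (Multiset.mem_map_of_mem _ he0)
      rw [Multiset.mem_add, Multiset.mem_map, Multiset.mem_map] at h0
      rcases h0 with ⟨f, hf, h⟩ | ⟨f, hf, h⟩
      · exact habne _ _ h.symm
      · have := hia h
        subst this
        exact Finset.disjoint_left.1 hd he0 hf
    · rw [Multiset.nodup_add]
      refine ⟨A.nodup.map hia, B.nodup.map hib, ?_⟩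
      rw [Multiset.disjoint_left]
      intro t h1 h2
      rw [Multiset.mem_map] at h1 h2
      obtain ⟨e, _, rfl⟩ := h1
      obtain ⟨f, _, h⟩ := h2
      exact habne _ _ h.symm
    · intro t ht
      rw [Multiset.mem_add, Multiset.mem_map, Multiset.mem_map] at ht
      rcases ht with ⟨f, hf, rfl⟩ | ⟨f, hf, rfl⟩
      · exact (hGU f (hA hf)).1
      · exact (hGU f (hB hf)).2
    · intro t ht
      rw [Multiset.mem_add, Multiset.mem_map, Multiset.mem_map] at ht
      rcases ht with ⟨f, hf, rfl⟩ | ⟨f, hf, rfl⟩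
      · exact (Finset.mem_sdiff.1 (hGU f (hA hf)).2).1
      · exact (Finset.mem_sdiff.1 (hGU f (hB hf)).1).1
    · have key : ∀ (E : Finset (Sym2 V)) (c i j : Fin v),
          Multiset.countP (fun t => i ∈ t ∧ j ∈ t) (E.val.map (fun e => insert c (φ e))) =
          (E.filter (fun e => i ∈ insert c (φ e) ∧ j ∈ insert c (φ e))).card := by
        intro E c i j
        rw [Multiset.countP_map]
        rfl
      have hdeg' : ∀ j : Fin v, j ≠ a → j ≠ b →
          (A.filter (fun e => j ∈ φ e)).card = (B.filter (fun e => j ∈ φ e)).card := by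
        intro j h1 h2
        have hj : j ∉ ({a, b} : Finset (Fin v)) := by simp [h1, h2]
        have h3 : ∀ e, j ∈ φ e ↔ (⟨j, hj⟩ : V) ∈ e := by
          intro e; rw [hφ]; exact ⟨fun h => h.2, fun h => ⟨hj, h⟩⟩
        simp only [h3]
        exact hdeg ⟨j, hj⟩
      have hba := hab.symm
      intro i _ j _ hij
      rw [Multiset.countP_add, Multiset.countP_add, key, key, key, key]
      by_cases hi1 : i = a
      · subst hi1
        by_cases hj2 : j = b
        · subst hj2
          simp [hφa, hφb, hab, hba]
        · simp [hφa, hφb, hab, hij.symm, hj2, hdeg' j hij.symm hj2]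
      · by_cases hi2 : i = b
        · subst hi2
          by_cases hj2 : j = a
          · subst hj2
            simp [hφa, hφb, hab, hba]
          · simp [hφa, hφb, hba, hij.symm, hj2, hdeg' j hj2 hij.symm]
        · by_cases hj1 : j = a
          · subst hj1
            simp [hφa, hφb, hab, hij, hi2, hdeg' i hi1 hi2]
          · by_cases hj2 : j = b
            · subst hj2
              simp [hφa, hφb, hba, hij, hi1, hdeg' i hi1 hi2]
            · simp [hi1, hi2, hj1, hj2])
  have hcount : (Finset.univ.filter (fun q : Fin v × Fin v =>
      {a, q.1, q.2} ∈ U ∧ {b, q.1, q.2} ∈ U)).card ≤ 2 * G.edgeSet.ncard := by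
    rw [← SimpleGraph.coe_edgeFinset, Set.ncard_coe_finset, ← G.dart_card_eq_twice_card_edges,
      ← Finset.card_univ (α := G.Dart)]
    apply Finset.card_le_card_of_surjOn (fun d : G.Dart => (d.fst.1, d.snd.1))
    rintro ⟨x, y⟩ h
    simp only [Finset.coe_filter, Finset.mem_univ, true_and, Set.mem_ofPred_eq] at h
    have h3 : ∀ c, ({c, x, y} : Finset (Fin v)) ∈ U → c ≠ x ∧ c ≠ y ∧ x ≠ y := by
      intro c hc
      have h4 := hU3 _ hc
      refine ⟨?_, ?_, ?_⟩ <;> rintro rfl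
      · have := Finset.card_le_two (a := c) (b := y)
        simp at h4; omega
      · have := Finset.card_le_two (a := c) (b := x)
        rw [Finset.pair_comm] at h4
        simp at h4; omega
      · have := Finset.card_le_two (a := c) (b := x)
        simp at h4; omega
    obtain ⟨h5, h6, h7⟩ := h3 a h.1
    obtain ⟨h8, h9, _⟩ := h3 b h.2
    have hx : x ∉ ({a, b} : Finset (Fin v)) := by simp [h5.symm, h8.symm]
    have hy : y ∉ ({a, b} : Finset (Fin v)) := by simp [h6.symm, h9.symm]
    refine ⟨⟨(⟨x, hx⟩, ⟨y, hy⟩), ?_⟩, by simp, rfl⟩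
    exact ⟨fun h => h7 (congrArg Subtype.val h), h.1, h.2⟩
  omega

theorem six_card_le (v : ℕ) (U : Finset (Finset (Fin v))) (hU : ∀ t ∈ U, t.card = 3) :
    6 * U.card ≤ ((Finset.univ ×ˢ Finset.univ.offDiag).filter
      (fun w : Fin v × (Fin v × Fin v) => {w.1, w.2.1, w.2.2} ∈ U)).card := by
  classical
  set W := (Finset.univ ×ˢ Finset.univ.offDiag).filter
      (fun w : Fin v × (Fin v × Fin v) => ({w.1, w.2.1, w.2.2} : Finset (Fin v)) ∈ U) with hW
  rw [Finset.card_eq_sum_card_fiberwise (s := W) (t := U)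
    (f := fun w => {w.1, w.2.1, w.2.2}) (fun w hw => (Finset.mem_filter.1 hw).2), mul_comm,
    ← smul_eq_mul]
  apply Finset.card_nsmul_le_sum
  intro t ht
  obtain ⟨p, q, r, h1, h2, h3, rfl⟩ := Finset.card_eq_three.1 (hU t ht)
  have h6 : ({(p, q, r), (p, r, q), (q, p, r), (q, r, p), (r, p, q), (r, q, p)} :
      Finset (Fin v × (Fin v × Fin v))).card = 6 := by
    simp [Finset.card_insert_of_notMem, h1, h2, h3, h1.symm, h2.symm, h3.symm]
  rw [← h6]
  apply Finset.card_le_card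
  have key : ∀ x y z : Fin v, y ≠ z → ({x, y, z} : Finset (Fin v)) = {p, q, r} →
      (x, y, z) ∈ W.filter (fun w => ({w.1, w.2.1, w.2.2} : Finset (Fin v)) = {p, q, r}) := by
    intro x y z hyz hxyz
    rw [Finset.mem_filter, hW, Finset.mem_filter]
    refine ⟨⟨by simp [hyz], ?_⟩, hxyz⟩
    simpa only [hxyz] using ht
  intro w hw
  simp only [Finset.mem_insert, Finset.mem_singleton] at hw
  rcases hw with rfl | rfl | rfl | rfl | rfl | rfl
  · exact key _ _ _ h3 rfl
  · exact key _ _ _ h3.symm (by rw [Finset.pair_comm r q])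
  · exact key _ _ _ h2 (by rw [Finset.insert_comm q p])
  · exact key _ _ _ h2.symm (by rw [Finset.pair_comm r p, Finset.insert_comm q p])
  · exact key _ _ _ h1 (by rw [Finset.insert_comm r p, Finset.pair_comm r q])
  · exact key _ _ _ h1.symm (by rw [Finset.pair_comm q p, Finset.insert_comm r p, Finset.pair_comm r q])

/-- If `v ≥ 4` and `D` is a defining set for the full design `F(v,3)`, then
`|D| ≥ v(v−1)(v − 5/2 − √((32v−85)/12))/6`. -/
theorem definingSet_full_design_three_lower_bound (v : ℕ) (hv : 4 ≤ v)
    (D : Finset (Finset (Fin v)))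
    (hD : IsDefiningSetOn (Finset.univ : Finset (Fin v)) 3 D) :
    (D.card : ℝ) ≥
      (v : ℝ) * ((v : ℝ) - 1) *
        ((v : ℝ) - 5 / 2 - Real.sqrt ((32 * (v : ℝ) - 85) / 12)) / 6 := by
  classical
  set U := fullDesignOn (Finset.univ : Finset (Fin v)) 3 \ D with hU
  have hU3 : ∀ t ∈ U, t.card = 3 := fun t ht =>
    (Finset.mem_powersetCard.1 (Finset.mem_sdiff.1 ht).1).2
  let O : Finset (Fin v × Fin v) := Finset.univ.offDiag
  let f : Fin v → Fin v × Fin v → ℝ := fun a q => if {a, q.1, q.2} ∈ U then 1 else 0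
  let d : Fin v × Fin v → ℝ := fun q => ∑ a, f a q
  obtain ⟨X, hX⟩ : ∃ X : ℝ, X = ∑ q ∈ O, d q := ⟨_, rfl⟩
  obtain ⟨c, hc⟩ : ∃ c : ℝ, c = (8 * (v : ℝ) - 22) / 3 := ⟨_, rfl⟩
  have hv' : (4 : ℝ) ≤ v := by exact_mod_cast hv
  have hOcard : (O.card : ℝ) = v * (v - 1) := by
    have : O.card = v * v - v := by simp [O, Finset.offDiag_card]
    rw [this, Nat.cast_sub (Nat.le_mul_self v)]
    push_cast; ring
  have hXU : 6 * (U.card : ℝ) ≤ X := by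
    have h1 := six_card_le v U hU3
    have h2 : X = (((Finset.univ ×ˢ Finset.univ.offDiag).filter
      (fun w : Fin v × (Fin v × Fin v) => ({w.1, w.2.1, w.2.2} : Finset (Fin v)) ∈ U)).card : ℝ) := by
      rw [hX, Finset.sum_comm, ← Finset.sum_product' (f := f), Finset.card_filter]
      push_cast
      rfl
    rw [h2]
    exact_mod_cast h1
  have hN : ∀ a b, ∑ q ∈ O, f a q * f b q ≤ if a = b then ∑ q ∈ O, f a q else c := by
    intro a b
    split_ifs with hab
    · subst hab
      apply Finset.sum_le_sum
      intro q _
      simp only [f]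
      split_ifs <;> simp
    · have h1 := pair_bound v hv D hD a b hab
      rw [← hU] at h1
      have h2 : ∑ q ∈ O, f a q * f b q ≤ ∑ q, f a q * f b q := by
        apply Finset.sum_le_sum_of_subset_of_nonneg (Finset.subset_univ _)
        intro q _ _
        simp only [f]
        split_ifs <;> simp
      have h3 : ∑ q, f a q * f b q = ((Finset.univ.filter (fun q : Fin v × Fin v =>
          ({a, q.1, q.2} : Finset (Fin v)) ∈ U ∧ ({b, q.1, q.2} : Finset (Fin v)) ∈ U)).card : ℝ) := by
        rw [Finset.card_filter]
        push_cast
        apply Finset.sum_congr rfl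
        intro q _
        simp only [f]
        split_ifs <;> simp_all
      have h4 : 3 * (∑ q, f a q * f b q) + 22 ≤ 8 * (v : ℝ) := by
        rw [h3]; exact_mod_cast h1
      rw [hc]
      linarith
  have hsq : ∑ q ∈ O, d q ^ 2 ≤ X + v * (v - 1) * c := by
    have h1 : ∑ q ∈ O, d q ^ 2 = ∑ a, ∑ b, ∑ q ∈ O, f a q * f b q := by
      have : ∀ q, d q ^ 2 = ∑ a, ∑ b, f a q * f b q := by
        intro q; rw [sq, Finset.sum_mul_sum]
      simp only [this]
      rw [Finset.sum_comm]
      apply Finset.sum_congr rfl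
      intro a _
      rw [Finset.sum_comm]
    have h2 : ∑ a : Fin v, ∑ b : Fin v, (if a = b then ∑ q ∈ O, f a q else c) =
        X + v * (v - 1) * c := by
      have : ∀ a : Fin v, ∑ b : Fin v, (if a = b then ∑ q ∈ O, f a q else c) =
          ∑ q ∈ O, f a q + (v - 1) * c := by
        intro a
        have h3 : ∀ b : Fin v, (if a = b then ∑ q ∈ O, f a q else c) =
            (if a = b then ∑ q ∈ O, f a q - c else 0) + c := by
          intro b; split_ifs <;> ring
        simp only [h3]
        rw [Finset.sum_add_distrib, Finset.sum_ite_eq]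
        simp
        ring
      simp only [this]
      rw [Finset.sum_add_distrib, hX, Finset.sum_comm]
      simp [d]
      ring
    rw [h1, ← h2]
    exact Finset.sum_le_sum fun a _ => Finset.sum_le_sum fun b _ => hN a b
  have hcs : X ^ 2 ≤ v * (v - 1) * ∑ q ∈ O, d q ^ 2 := by
    rw [← hOcard, hX]
    exact sq_sum_le_card_mul_sum_sq
  obtain ⟨M, hM⟩ : ∃ M : ℝ, M = v * (v - 1) := ⟨_, rfl⟩
  have hM0 : 0 < M := by rw [hM]; nlinarith
  rw [← hM] at hsq hcs
  have hs : Real.sqrt ((32 * (v : ℝ) - 85) / 12) ^ 2 = (32 * (v : ℝ) - 85) / 12 :=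
    Real.sq_sqrt (by linarith)
  have hs0 := Real.sqrt_nonneg ((32 * (v : ℝ) - 85) / 12)
  have hkey : X - M / 2 ≤ M * Real.sqrt ((32 * (v : ℝ) - 85) / 12) := by
    refine abs_le_of_sq_le_sq' ?_ (by positivity) |>.2
    rw [mul_pow, hs]
    have h1 : X ^ 2 ≤ M * (X + M * c) := hcs.trans (mul_le_mul_of_nonneg_left hsq hM0.le)
    rw [hc] at h1
    nlinarith
  have hcardU : (U.card : ℝ) + D.card = v * (v - 1) * (v - 2) / 6 := by
    have h1 : U.card + D.card = v.choose 3 := by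
      rw [hU, Finset.card_sdiff_add_card_eq_card hD.1]
      simp [fullDesignOn]
    have h2 : ((v.choose 3 : ℕ) : ℝ) = v * (v - 1) * (v - 2) / 6 := by
      have h3 := Nat.descFactorial_eq_factorial_mul_choose v 3
      obtain ⟨n, rfl⟩ := Nat.exists_eq_add_of_le hv
      have h4 : (4 + n).descFactorial 3 = (4 + n) * (3 + n) * (2 + n) := by
        simp [Nat.descFactorial]
        have e1 : 4 + n - 2 = 2 + n := by omega
        rw [e1]; ring
      rw [h4] at h3
      have h5 : ((4 : ℝ) + n) * (3 + n) * (2 + n) = 6 * ((4 + n).choose 3 : ℕ) := by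
        have : Nat.factorial 3 = 6 := rfl
        rw [this] at h3
        exact_mod_cast h3
      push_cast
      linear_combination -h5 / 6
    rw [← h2, ← h1]
    push_cast; ring
  rw [← hM] at hcardU ⊢
  nlinarith
end

section
/- Let k ≥ 3, v ≥ k+1, let D be a defining set for the full design F(v,k), and let K ⊆ {1,…,v} with |K| = k−3. Let D_K be the set of blocks of D containing K, and let B_K be the set of 3-subsets of {1,…,v}\K obtained by deleting K from each block of D_K. Then B_K is a defining set for the full design on the (v−k+3)-element point set {1,…,v}\K with block size 3. -/
lemma full_pair {α : Type*} [DecidableEq α] (P : Finset α) (k : ℕ) (hk : 2 ≤ k) (i j : α)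
    (hi : i ∈ P) (hj : j ∈ P) (hij : i ≠ j) :
    Multiset.countP (fun b => i ∈ b ∧ j ∈ b) (fullDesignOn P k).val
      = (P.card - 2).choose (k - 2) := by
  rw [Multiset.countP_eq_card_filter]
  change ((fullDesignOn P k).filter (fun b => i ∈ b ∧ j ∈ b)).card = _
  have h2 : ({i, j} : Finset α).card = 2 := Finset.card_pair hij
  have hsub : ({i, j} : Finset α) ⊆ P := by
    intro x hx; simp at hx; rcases hx with rfl | rfl <;> assumption
  have h3 : (P \ {i, j}).card = P.card - 2 := by
    rw [Finset.card_sdiff_of_subset hsub, h2]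
  rw [← h3, ← Finset.card_powersetCard]
  refine Finset.card_bij' (fun b _ => b \ {i, j}) (fun b _ => b ∪ {i, j}) ?_ ?_ ?_ ?_
  · intro b hb
    simp only [fullDesignOn, Finset.mem_filter, Finset.mem_powersetCard] at hb ⊢
    have hs : ({i, j} : Finset α) ⊆ b := by
      intro x hx; simp at hx; rcases hx with rfl | rfl <;> tauto
    exact ⟨Finset.sdiff_subset_sdiff hb.1.1 le_rfl, by
      rw [Finset.card_sdiff_of_subset hs, h2, hb.1.2]⟩
  · intro b hb
    simp only [fullDesignOn, Finset.mem_filter, Finset.mem_powersetCard] at hb ⊢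
    have hd : Disjoint b {i, j} := Finset.disjoint_of_subset_left hb.1 Finset.sdiff_disjoint
    refine ⟨⟨Finset.union_subset (hb.1.trans Finset.sdiff_subset) hsub, ?_⟩, by simp, by simp⟩
    rw [Finset.card_union_of_disjoint hd, h2, hb.2]; omega
  · intro b hb
    simp only [fullDesignOn, Finset.mem_filter, Finset.mem_powersetCard] at hb
    have hs : ({i, j} : Finset α) ⊆ b := by
      intro x hx; simp at hx; rcases hx with rfl | rfl <;> tauto
    exact Finset.sdiff_union_of_subset hs
  · intro b hb
    simp only [Finset.mem_powersetCard] at hb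
    have hd : Disjoint b {i, j} := Finset.disjoint_of_subset_left hb.1 Finset.sdiff_disjoint
    exact Finset.union_sdiff_cancel_right hd

lemma full_isDesign {α : Type*} [DecidableEq α] (P : Finset α) (k : ℕ) (hk : 2 ≤ k) :
    IsDesignOn P k ((P.card - 2).choose (k - 2)) (fullDesignOn P k).val := by
  refine ⟨fun b hb => Finset.mem_powersetCard.1 hb, fun i hi j hj hij => ?_⟩
  exact full_pair P k hk i j hi hj hij

lemma sum_pair {α : Type*} [DecidableEq α] (P : Finset α) (i : α) (A : Multiset (Finset α)) :
    (∀ b ∈ A, b ⊆ P ∧ b.card = 3) →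
    ∑ j ∈ P.erase i, Multiset.countP (fun b => i ∈ b ∧ j ∈ b) A
      = 2 * Multiset.countP (fun b => i ∈ b) A := by
  induction A using Multiset.induction_on with
  | empty => simp
  | cons a A ih =>
    intro h
    have ha := h a (by simp)
    have ih := ih (fun b hb => h b (by simp [hb]))
    simp only [Multiset.countP_cons, Finset.sum_add_distrib, ih, mul_add]
    congr 1
    by_cases hia : i ∈ a
    · simp only [hia, true_and, if_true, Finset.sum_ite_mem, ← Finset.card_eq_sum_ones]
      have : P.erase i ∩ a = a.erase i := by
        ext x; simp only [Finset.mem_inter, Finset.mem_erase]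
        have := @ha.1 x; tauto
      rw [this, Finset.card_erase_of_mem hia, ha.2]
    · simp [hia]

lemma sum_single {α : Type*} [DecidableEq α] (P : Finset α) (A : Multiset (Finset α)) :
    (∀ b ∈ A, b ⊆ P ∧ b.card = 3) →
    ∑ j ∈ P, Multiset.countP (fun b => j ∈ b) A = 3 * Multiset.card A := by
  induction A using Multiset.induction_on with
  | empty => simp
  | cons a A ih =>
    intro h
    have ha := h a (by simp)
    have ih := ih (fun b hb => h b (by simp [hb]))
    simp only [Multiset.countP_cons, Finset.sum_add_distrib, ih, mul_add, Multiset.card_cons]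
    congr 1
    simp only [Finset.sum_ite_mem, ← Finset.card_eq_sum_ones]
    rw [Finset.inter_eq_right.2 ha.1, ha.2]

lemma design_single {α : Type*} [DecidableEq α] {P : Finset α} {l : ℕ}
    {A B : Multiset (Finset α)} (hA : IsDesignOn P 3 l A) (hB : IsDesignOn P 3 l B)
    (i : α) (hi : i ∈ P) :
    Multiset.countP (fun b => i ∈ b) A = Multiset.countP (fun b => i ∈ b) B := by
  have h1 := sum_pair P i A hA.1
  have h2 := sum_pair P i B hB.1
  have : ∑ j ∈ P.erase i, Multiset.countP (fun b => i ∈ b ∧ j ∈ b) A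
      = ∑ j ∈ P.erase i, Multiset.countP (fun b => i ∈ b ∧ j ∈ b) B := by
    refine Finset.sum_congr rfl fun j hj => ?_
    rw [Finset.mem_erase] at hj
    rw [hA.2 i hi j hj.2 hj.1.symm, hB.2 i hi j hj.2 hj.1.symm]
  omega

lemma design_card {α : Type*} [DecidableEq α] {P : Finset α} {l : ℕ}
    {A B : Multiset (Finset α)} (hA : IsDesignOn P 3 l A) (hB : IsDesignOn P 3 l B) :
    Multiset.card A = Multiset.card B := by
  have h1 := sum_single P A hA.1
  have h2 := sum_single P B hB.1
  have : ∑ j ∈ P, Multiset.countP (fun b => j ∈ b) A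
      = ∑ j ∈ P, Multiset.countP (fun b => j ∈ b) B :=
    Finset.sum_congr rfl fun j hj => design_single hA hB j hj
  omega

lemma lift_count {α : Type*} [DecidableEq α] {P K : Finset α} {l : ℕ}
    {A B : Multiset (Finset α)} (hA : IsDesignOn (P \ K) 3 l A) (hB : IsDesignOn (P \ K) 3 l B)
    (i j : α) (hi : i ∈ P) (hj : j ∈ P) (hij : i ≠ j) :
    Multiset.countP (fun b => i ∈ b ∧ j ∈ b) (A.map (· ∪ K))
      = Multiset.countP (fun b => i ∈ b ∧ j ∈ b) (B.map (· ∪ K)) := by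
  simp only [Multiset.countP_map, ← Multiset.countP_eq_card_filter, Finset.mem_union]
  by_cases h1 : i ∈ K <;> by_cases h2 : j ∈ K
  · simpa [h1, h2] using design_card hA hB
  · simpa [h1, h2] using design_single hA hB j (by simp [hj, h2])
  · simpa [h1, h2] using design_single hA hB i (by simp [hi, h1])
  · simp only [h1, h2, or_false]
    rw [hA.2 i (by simp [hi, h1]) j (by simp [hj, h2]) hij,
      hB.2 i (by simp [hi, h1]) j (by simp [hj, h2]) hij]

lemma map_sdiff {α : Type*} [DecidableEq α] {P K : Finset α}
    (A : Multiset (Finset α)) (hA : ∀ b ∈ A, b ⊆ P \ K) :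
    (A.map (· ∪ K)).map (· \ K) = A := by
  rw [Multiset.map_map]
  conv_rhs => rw [← Multiset.map_id A]
  refine Multiset.map_congr rfl fun b hb => ?_
  exact Finset.union_sdiff_cancel_right
    (Finset.disjoint_of_subset_left (hA b hb) Finset.sdiff_disjoint)

lemma full_split {α : Type*} [DecidableEq α] {P K : Finset α} {k : ℕ} (hKP : K ⊆ P) (hk : 3 ≤ k)
    (hK : K.card = k - 3) :
    (fullDesignOn P k).val = ((fullDesignOn P k).filter (fun b => ¬ K ⊆ b)).val
      + (fullDesignOn (P \ K) 3).val.map (· ∪ K) := by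
  have h : (fullDesignOn (P \ K) 3).val.map (· ∪ K)
      = ((fullDesignOn P k).filter (fun b => K ⊆ b)).val := by
    have hd : ∀ b ∈ (fullDesignOn (P \ K) 3).val, Disjoint b K := fun b hb =>
      Finset.disjoint_of_subset_left (Finset.mem_powersetCard.1 hb).1 Finset.sdiff_disjoint
    refine (Multiset.Nodup.ext (Multiset.Nodup.map_on ?_ (Finset.nodup _)) (Finset.nodup _)).2 ?_
    · intro x hx y hy hxy
      have := congrArg (· \ K) hxy
      simpa only [Finset.union_sdiff_cancel_right (hd x hx),
        Finset.union_sdiff_cancel_right (hd y hy)] using this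
    · intro b
      simp only [Multiset.mem_map, Finset.mem_val, Finset.mem_filter]
      constructor
      · rintro ⟨a, ha, rfl⟩
        have hda := hd a ha
        rw [fullDesignOn, Finset.mem_powersetCard] at ha
        refine ⟨Finset.mem_powersetCard.2 ⟨Finset.union_subset (ha.1.trans Finset.sdiff_subset) hKP,
          ?_⟩, Finset.subset_union_right⟩
        rw [Finset.card_union_of_disjoint hda, ha.2, hK]; omega
      · rintro ⟨hb, hKb⟩
        rw [fullDesignOn, Finset.mem_powersetCard] at hb
        refine ⟨b \ K, Finset.mem_powersetCard.2 ⟨Finset.sdiff_subset_sdiff hb.1 le_rfl, ?_⟩,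
          Finset.sdiff_union_of_subset hKb⟩
        rw [Finset.card_sdiff_of_subset hKb, hb.2, hK]; omega
  rw [h, add_comm]
  exact (Multiset.filter_add_not _ _).symm

/-- Let `k ≥ 3`, `v ≥ k+1`, let `D` be a defining set for the full design `F(v,k)` and let
`K` be a set of `k−3` points. Let `D_K` be the set of blocks of `D` containing `K` and let
`B_K` be the set of 3-subsets of `{1,…,v} \ K` obtained by deleting `K` from each block of
`D_K`. Then `B_K` is a defining set for the full design on the point set `{1,…,v} \ K`
with block size `3`. -/
theorem derived_definingSet (v k : ℕ) (hk : 3 ≤ k) (hv : k + 1 ≤ v)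
    (D : Finset (Finset (Fin v)))
    (hD : IsDefiningSetOn (Finset.univ : Finset (Fin v)) k D)
    (K : Finset (Fin v)) (hK : K.card = k - 3) :
    IsDefiningSetOn (Finset.univ \ K) 3
      ((D.filter (fun b => K ⊆ b)).image (fun b => b \ K)) := by
  have hKP : K ⊆ Finset.univ := Finset.subset_univ K
  have hsplit := full_split hKP hk hK
  refine ⟨?_, ?_⟩
  · intro b hb
    simp only [Finset.mem_image, Finset.mem_filter] at hb
    obtain ⟨a, ⟨haD, hKa⟩, rfl⟩ := hb
    have ha := Finset.mem_powersetCard.1 (hD.1 haD)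
    refine Finset.mem_powersetCard.2 ⟨Finset.sdiff_subset_sdiff ha.1 le_rfl, ?_⟩
    rw [Finset.card_sdiff_of_subset hKa, ha.2, hK]; omega
  · intro B hB hle
    have hF := full_isDesign (Finset.univ \ K) 3 (by norm_num)
    have hG := full_isDesign (Finset.univ : Finset (Fin v)) k (by omega)
    have key := hD.2 (((fullDesignOn Finset.univ k).filter (fun b => ¬ K ⊆ b)).val
      + B.map (· ∪ K)) ?_ ?_
    · rw [hsplit] at key
      have key := congrArg (Multiset.map (· \ K)) (add_left_cancel key)
      rwa [map_sdiff B (fun b hb => (hB.1 b hb).1),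
        map_sdiff _ (fun b hb => (hF.1 b hb).1)] at key
    · refine ⟨?_, ?_⟩
      · intro b hb
        rcases Multiset.mem_add.1 hb with hb | hb
        · rw [Finset.mem_val, Finset.mem_filter] at hb
          exact hG.1 b (by rw [Finset.mem_val]; exact hb.1)
        · obtain ⟨a, ha, rfl⟩ := Multiset.mem_map.1 hb
          have h := hB.1 a ha
          refine ⟨Finset.subset_univ _, ?_⟩
          rw [Finset.card_union_of_disjoint
            (Finset.disjoint_of_subset_left h.1 Finset.sdiff_disjoint), h.2, hK]
          omega
      · intro i hi j hj hij
        rw [← hG.2 i hi j hj hij, hsplit, Multiset.countP_add, Multiset.countP_add,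
          lift_count hB hF i j hi hj hij]
    · refine (Multiset.le_iff_subset D.nodup).2 fun b hb => ?_
      rw [Multiset.mem_add]
      by_cases hKb : K ⊆ b
      · right
        refine Multiset.mem_map.2 ⟨b \ K, ?_, Finset.sdiff_union_of_subset hKb⟩
        exact Multiset.mem_of_le hle (Finset.mem_image.2 ⟨b, Finset.mem_filter.2 ⟨hb, hKb⟩, rfl⟩)
      · left
        exact Finset.mem_filter.2 ⟨hD.1 hb, hKb⟩
end
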